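/- arXiv:1410.2482 — 3 statements merged into one kernel-verified Lean document; each statement's English description precedes it below -/
import Mathlib

section
/- The orbit space X/T⁴ of the canonical T⁴-action on the Grassmannian G₄,₂ (realized as the Plücker quadric X) is homeomorphic to the quotient space (Δ₄,₂ × ℂP¹)/≈, where (x, c) ≈ (y, c′) if and only if (x, c) = (y, c′), or x = y and x ∈ ∂Δ₄,₂. -/
/-- Proportionality of nonzero vectors of `ℂ⁶`: the relation defining `ℂP⁵`. -/
def projRel (x y : {w : Fin 6 → ℂ // w ≠ 0}) : Prop :=
  ∃ c : ℂ, c ≠ 0 ∧ (fun k => c * x.1 k) = y.1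

/-- `ℂP⁵`, with the quotient topology. -/
abbrev CP5 := Quot projRel

/-- Proportionality of nonzero vectors of `ℂ²`: the relation defining `ℂP¹`. -/
def projRel1 (x y : {w : Fin 2 → ℂ // w ≠ 0}) : Prop :=
  ∃ c : ℂ, c ≠ 0 ∧ (fun k => c * x.1 k) = y.1

/-- `ℂP¹`, with the quotient topology. -/
abbrev CP1 := Quot projRel1

/-- The Plücker quadric `X = {[w] ∈ ℂP⁵ : w₀w₅ + w₂w₃ = w₁w₄}`, i.e. the Grassmannian
`G₄,₂` under the Plücker embedding, with the subspace topology. -/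
def pluckerQuadric : Set CP5 :=
  {p | ∃ w : {w : Fin 6 → ℂ // w ≠ 0}, Quot.mk projRel w = p ∧
        w.1 0 * w.1 5 + w.1 2 * w.1 3 = w.1 1 * w.1 4}

/-- The weights of the `T⁴`-action on `ℂP⁵` coming from the second symmetric power. -/
def torusCoef (t : Fin 4 → ℂ) : Fin 6 → ℂ :=
  ![t 0 * t 1, t 0 * t 2, t 0 * t 3, t 1 * t 2, t 1 * t 3, t 2 * t 3]

/-- Two points of `X` lie in the same orbit of the compact torus
`T⁴ = {t ∈ ℂ⁴ : |tᵢ| = 1}`: some `t ∈ T⁴` carries a representative of the first point to a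
representative of the second. -/
def orbitRel (p q : ↥pluckerQuadric) : Prop :=
  ∃ t : Fin 4 → ℂ, (∀ i, ‖t i‖ = 1) ∧
    ∃ w w' : {w : Fin 6 → ℂ // w ≠ 0},
      Quot.mk projRel w = p.1 ∧ Quot.mk projRel w' = q.1 ∧
      ∀ k : Fin 6, w'.1 k = torusCoef t k * w.1 k

/-- The hypersimplex (octahedron) `Δ₄,₂ = {x ∈ ℝ⁴ : 0 ≤ xᵢ ≤ 1, Σxᵢ = 2}`. -/
def hypersimplex : Set (Fin 4 → ℝ) :=
  {x | (∀ i, 0 ≤ x i ∧ x i ≤ 1) ∧ x 0 + x 1 + x 2 + x 3 = 2}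

/-- The boundary `∂Δ₄,₂`: points of `Δ₄,₂` having some coordinate equal to `0` or `1`. -/
def hypersimplexBoundary : Set (Fin 4 → ℝ) :=
  {x | x ∈ hypersimplex ∧ ∃ i, x i = 0 ∨ x i = 1}

/-- The gluing relation on `Δ₄,₂ × ℂP¹`: `(x,c) ≈ (y,c′)` iff `(x,c) = (y,c′)` or
(`x = y` and `x ∈ ∂Δ₄,₂`). -/
def glueRel (p q : ↥hypersimplex × CP1) : Prop :=
  p = q ∨ (p.1 = q.1 ∧ (p.1 : Fin 4 → ℝ) ∈ hypersimplexBoundary)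

open ComplexConjugate in
/-- Pairs with equal moduli and equal Hermitian product differ by a unit scalar. -/
lemma exists_unit_of_herm {a b a' b' : ℂ} (ha : ‖a‖ = ‖a'‖) (hb : ‖b‖ = ‖b'‖)
    (h : a * conj b = a' * conj b') :
    ∃ u : ℂ, ‖u‖ = 1 ∧ a' = u * a ∧ b' = u * b := by
  by_cases h0 : a = 0
  · have h0' : a' = 0 := by
      rw [h0, norm_zero] at ha
      exact norm_eq_zero.1 ha.symm
    by_cases h1 : b = 0
    · have h1' : b' = 0 := by
        rw [h1, norm_zero] at hb
        exact norm_eq_zero.1 hb.symm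
      exact ⟨1, by simp, by simp [h0, h0'], by simp [h1, h1']⟩
    · refine ⟨b' / b, ?_, by simp [h0, h0'], by field_simp⟩
      rw [norm_div, ← hb, div_self (norm_ne_zero_iff.2 h1)]
  · have hn : ‖a‖ ≠ 0 := norm_ne_zero_iff.2 h0
    refine ⟨a' / a, by rw [norm_div, ← ha, div_self hn], by field_simp, ?_⟩
    have h2 : conj a * b = conj a' * b' := by
      have := congrArg conj h
      simpa using this
    have h3 : a * conj a = a' * conj a' := by
      rw [Complex.mul_conj', Complex.mul_conj', ha]
    have h0' : a' ≠ 0 := by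
      intro h'
      rw [h', norm_zero] at ha
      exact hn ha
    have h4 : conj a' ≠ 0 := (map_ne_zero _).2 h0'
    have h5 : conj a' * (a * b') = conj a' * (a' * b) := by
      linear_combination (-a) * h2 + b * h3
    have h6 := mul_left_cancel₀ h4 h5
    field_simp
    rw [mul_comm]; exact h6

lemma pair_unit {a b a' b' l : ℂ} (ha : ‖a‖ = ‖a'‖) (hb : ‖b‖ = ‖b'‖) (hl : ‖l‖ = 1)
    (h : a' * b' = l * (a * b)) :
    ∃ u v : ℂ, ‖u‖ = 1 ∧ ‖v‖ = 1 ∧ u * v = l ∧ a' = u * a ∧ b' = v * b := by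
  by_cases h0 : a = 0
  · have h0' : a' = 0 := by
      rw [h0, norm_zero] at ha
      exact norm_eq_zero.1 ha.symm
    obtain ⟨v, hv, hv'⟩ : ∃ v : ℂ, ‖v‖ = 1 ∧ b' = v * b := by
      by_cases h1 : b = 0
      · have h1' : b' = 0 := by
          rw [h1, norm_zero] at hb
          exact norm_eq_zero.1 hb.symm
        exact ⟨1, by simp, by simp [h1, h1']⟩
      · refine ⟨b' / b, ?_, by field_simp⟩
        rw [norm_div, ← hb, div_self (norm_ne_zero_iff.2 h1)]
    have hv0 : v ≠ 0 := by rintro rfl; simp at hv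
    exact ⟨l / v, v, by rw [norm_div, hl, hv, div_one], hv, by field_simp, by simp [h0, h0'], hv'⟩
  · have hn : ‖a‖ ≠ 0 := norm_ne_zero_iff.2 h0
    have h0' : a' ≠ 0 := by
      intro h'
      rw [h', norm_zero] at ha
      exact hn ha
    refine ⟨a' / a, l * a / a', by rw [norm_div, ← ha, div_self hn], ?_, by field_simp,
      by field_simp, ?_⟩
    · rw [norm_div, norm_mul, hl, one_mul, ← ha, div_self hn]
    · field_simp
      linear_combination h

lemma exists_sqrt_unit (z : ℂ) (hz : ‖z‖ = 1) : ∃ t : ℂ, ‖t‖ = 1 ∧ t * t = z := by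
  obtain ⟨t, ht⟩ := IsAlgClosed.exists_pow_nat_eq z (n := 2) (by norm_num)
  refine ⟨t, ?_, by rw [← ht]; ring⟩
  have : ‖t‖ ^ 2 = 1 := by rw [← norm_pow, ht, hz]
  nlinarith [norm_nonneg t]

open ComplexConjugate in
/-- The `T⁴`-invariants separate orbits on the quadric. -/
lemma exists_torus {w w' : Fin 6 → ℂ} (hw : w 0 * w 5 + w 2 * w 3 = w 1 * w 4)
    (hw' : w' 0 * w' 5 + w' 2 * w' 3 = w' 1 * w' 4) (hn : ∀ k, ‖w k‖ = ‖w' k‖)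
    (hz : w 0 * w 5 * conj (w 1 * w 4) = w' 0 * w' 5 * conj (w' 1 * w' 4)) :
    ∃ t : Fin 4 → ℂ, (∀ i, ‖t i‖ = 1) ∧ ∀ k, w' k = torusCoef t k * w k := by
  obtain ⟨l, hl, h0, h1⟩ := exists_unit_of_herm (by simp [hn]) (by simp [hn]) hz
  have h2 : w' 2 * w' 3 = l * (w 2 * w 3) := by linear_combination hw' - l * hw + h1 - h0
  obtain ⟨u0, u5, n0, n5, e0, f0, f5⟩ := pair_unit (hn 0) (hn 5) hl h0
  obtain ⟨u1, u4, n1, n4, e1, f1, f4⟩ := pair_unit (hn 1) (hn 4) hl h1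
  obtain ⟨u2, u3, n2, n3, e2, f2, f3⟩ := pair_unit (hn 2) (hn 3) hl h2
  have nz : ∀ u : ℂ, ‖u‖ = 1 → u ≠ 0 := by rintro u hu rfl; simp at hu
  have z0 := nz _ n0
  have z1 := nz _ n1
  have z3 := nz _ n3
  obtain ⟨t, ht, htt⟩ := exists_sqrt_unit (u0 * u1 / u3) (by simp [n0, n1, n3])
  have zt := nz _ ht
  have htt' : t * t * u3 = u0 * u1 := by rw [htt]; field_simp
  have k01 : t * (u0 / t) = u0 := by field_simp
  have k02 : t * (u1 / t) = u1 := by field_simp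
  have k03 : t * (u2 / t) = u2 := by field_simp
  have k12 : u0 / t * (u1 / t) = u3 := by
    field_simp; linear_combination -htt'
  have k13 : u0 / t * (u2 / t) = u4 := by
    field_simp
    apply mul_left_cancel₀ z1
    linear_combination (-u2) * htt' + t * t * (e2 - e1)
  have k23 : u1 / t * (u2 / t) = u5 := by
    field_simp
    apply mul_left_cancel₀ z0
    linear_combination (-u2) * htt' + t * t * (e2 - e0)
  refine ⟨![t, u0 / t, u1 / t, u2 / t], ?_, ?_⟩
  · intro i
    fin_cases i <;> simp [ht, n0, n1, n2]
  · intro k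
    fin_cases k <;> simp [torusCoef, k01, k02, k03, k12, k13, k23] <;> assumption

/-- Two nonnegative tuples with the same moments and comparable products agree. -/
lemma moduli_unique {a a' : Fin 6 → ℝ} (ha' : ∀ k, 0 ≤ a' k)
    (d1 : a 0 - a 5 = a' 0 - a' 5) (d2 : a 1 - a 4 = a' 1 - a' 4) (d3 : a 2 - a 3 = a' 2 - a' 3)
    (s : a 0 + a 1 + a 2 + a 3 + a 4 + a 5 = a' 0 + a' 1 + a' 2 + a' 3 + a' 4 + a' 5)
    (h1 : a 0 * a 5 ≤ a' 0 * a' 5) (h2 : a 1 * a 4 ≤ a' 1 * a' 4)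
    (h3 : a 2 * a 3 ≤ a' 2 * a' 3) : ∀ k, a k = a' k := by
  have key : ∀ p q p' q' : ℝ, 0 ≤ p' → 0 ≤ q' → p - q = p' - q' →
      p * q ≤ p' * q' → p + q ≤ p' + q' := by
    intro p q p' q' hp hq hd hm
    apply abs_le_of_sq_le_sq' _ (by positivity) |>.2
    have : (p - q) ^ 2 = (p' - q') ^ 2 := by rw [hd]
    nlinarith
  have k1 := key _ _ _ _ (ha' 0) (ha' 5) d1 h1
  have k2 := key _ _ _ _ (ha' 1) (ha' 4) d2 h2
  have k3 := key _ _ _ _ (ha' 2) (ha' 3) d3 h3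
  intro k
  fin_cases k <;> simp <;> linarith

lemma exists_factor {a b : ℝ} {z : ℂ} (ha : 0 ≤ a) (hb : 0 ≤ b) (h : a * b = ‖z‖ ^ 2) :
    ∃ u v : ℂ, ‖u‖ ^ 2 = a ∧ ‖v‖ ^ 2 = b ∧ u * v = z := by
  by_cases h0 : a = 0
  · refine ⟨0, (Real.sqrt b : ℝ), by simp [h0], ?_, ?_⟩
    · rw [Complex.norm_real, Real.norm_eq_abs, sq_abs, Real.sq_sqrt hb]
    · rw [h0, zero_mul] at h
      have : ‖z‖ = 0 := by simpa using h.symm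
      rw [norm_eq_zero.1 this, zero_mul]
  · have hs : Real.sqrt a ≠ 0 := (Real.sqrt_ne_zero ha).2 h0
    have hs' : ((Real.sqrt a : ℝ) : ℂ) ≠ 0 := by exact_mod_cast hs
    refine ⟨(Real.sqrt a : ℝ), z / (Real.sqrt a : ℝ), ?_, ?_, by field_simp⟩
    · rw [Complex.norm_real, Real.norm_eq_abs, sq_abs, Real.sq_sqrt ha]
    · rw [norm_div, Complex.norm_real, Real.norm_eq_abs, div_pow, sq_abs, Real.sq_sqrt ha, ← h]
      field_simp

/-- Moment map (on unit vectors). -/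
noncomputable def mu (w : Fin 6 → ℂ) : Fin 4 → ℝ :=
  ![‖w 0‖ ^ 2 + ‖w 1‖ ^ 2 + ‖w 2‖ ^ 2, ‖w 0‖ ^ 2 + ‖w 3‖ ^ 2 + ‖w 4‖ ^ 2,
    ‖w 1‖ ^ 2 + ‖w 3‖ ^ 2 + ‖w 5‖ ^ 2, ‖w 2‖ ^ 2 + ‖w 4‖ ^ 2 + ‖w 5‖ ^ 2]

/-- Squared norm on `ℂ⁶`. -/
noncomputable def nsq (w : Fin 6 → ℂ) : ℝ :=
  ‖w 0‖ ^ 2 + ‖w 1‖ ^ 2 + ‖w 2‖ ^ 2 + ‖w 3‖ ^ 2 + ‖w 4‖ ^ 2 + ‖w 5‖ ^ 2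

/-- Squared norm on `ℂ²`. -/
noncomputable def nsq2 (c : Fin 2 → ℂ) : ℝ := ‖c 0‖ ^ 2 + ‖c 1‖ ^ 2

/-- The correspondence space. -/
def corr : Set ((Fin 6 → ℂ) × (Fin 2 → ℂ)) :=
  {g | nsq g.1 = 1 ∧ nsq2 g.2 = 1 ∧ g.1 0 * g.1 5 + g.1 2 * g.1 3 = g.1 1 * g.1 4 ∧
    g.1 0 * g.1 5 * g.2 1 = g.1 1 * g.1 4 * g.2 0}

lemma nsq_pos {w : Fin 6 → ℂ} (h : w ≠ 0) : 0 < nsq w := by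
  by_contra hc
  apply h
  have h0 := sq_nonneg ‖w 0‖
  have h1 := sq_nonneg ‖w 1‖
  have h2 := sq_nonneg ‖w 2‖
  have h3 := sq_nonneg ‖w 3‖
  have h4 := sq_nonneg ‖w 4‖
  have h5 := sq_nonneg ‖w 5‖
  unfold nsq at hc
  funext k
  have : ‖w k‖ ^ 2 = 0 := by
    fin_cases k <;> simp only [Fin.zero_eta, Fin.mk_one, Fin.reduceFinMk] <;> linarith
  simpa using this

lemma nsq2_pos {w : Fin 2 → ℂ} (h : w ≠ 0) : 0 < nsq2 w := by
  by_contra hc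
  apply h
  have h0 := sq_nonneg ‖w 0‖
  have h1 := sq_nonneg ‖w 1‖
  unfold nsq2 at hc
  funext k
  have : ‖w k‖ ^ 2 = 0 := by
    fin_cases k <;> simp only [Fin.zero_eta, Fin.mk_one, Fin.reduceFinMk] <;> linarith
  simpa using this

lemma ne_zero_of_nsq {w : Fin 6 → ℂ} (h : nsq w = 1) : w ≠ 0 := by
  rintro rfl; simp [nsq] at h

lemma ne_zero_of_nsq2 {w : Fin 2 → ℂ} (h : nsq2 w = 1) : w ≠ 0 := by
  rintro rfl; simp [nsq2] at h

lemma nsq_smul (c : ℂ) (w : Fin 6 → ℂ) : nsq (fun k => c * w k) = ‖c‖ ^ 2 * nsq w := by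
  simp [nsq]; ring

lemma nsq2_smul (c : ℂ) (w : Fin 2 → ℂ) : nsq2 (fun k => c * w k) = ‖c‖ ^ 2 * nsq2 w := by
  simp [nsq2]; ring

lemma exists_scale {N : ℝ} (h : 0 < N) : ∃ c : ℂ, c ≠ 0 ∧ ‖c‖ ^ 2 * N = 1 := by
  have hs : Real.sqrt N ≠ 0 := (Real.sqrt_pos.2 h).ne'
  refine ⟨((Real.sqrt N)⁻¹ : ℝ), by exact_mod_cast inv_ne_zero hs, ?_⟩
  rw [Complex.norm_real, Real.norm_eq_abs, sq_abs, inv_pow, Real.sq_sqrt h.le,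
    inv_mul_cancel₀ h.ne']

lemma mu_mem {w : Fin 6 → ℂ} (h : nsq w = 1) : mu w ∈ hypersimplex := by
  have h0 := sq_nonneg ‖w 0‖
  have h1 := sq_nonneg ‖w 1‖
  have h2 := sq_nonneg ‖w 2‖
  have h3 := sq_nonneg ‖w 3‖
  have h4 := sq_nonneg ‖w 4‖
  have h5 := sq_nonneg ‖w 5‖
  unfold nsq at h
  constructor
  · intro i
    fin_cases i <;> simp [mu] <;> constructor <;> linarith
  · simp [mu]; linarith

lemma corr_lambda {g : (Fin 6 → ℂ) × (Fin 2 → ℂ)} (hg : g ∈ corr) :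
    ∃ l : ℂ, g.1 0 * g.1 5 = l * g.2 0 ∧ g.1 1 * g.1 4 = l * g.2 1 ∧
      g.1 2 * g.1 3 = l * (g.2 1 - g.2 0) := by
  obtain ⟨-, h2, h3, h4⟩ := hg
  by_cases h0 : g.2 0 = 0
  · have h1 : g.2 1 ≠ 0 := by
      intro h1; simp [nsq2, h0, h1] at h2
    have : g.1 0 * g.1 5 = 0 := by
      rw [h0, mul_zero] at h4
      exact (mul_eq_zero.1 h4).resolve_right h1
    refine ⟨g.1 1 * g.1 4 / g.2 1, by rw [this, h0, mul_zero], by field_simp, ?_⟩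
    rw [h0]; field_simp; rw [sub_zero]; linear_combination g.2 1 * (h3 - this)
  · refine ⟨g.1 0 * g.1 5 / g.2 0, by field_simp, ?_, ?_⟩
    · field_simp; linear_combination -h4
    · field_simp; linear_combination g.2 0 * h3 - h4

lemma boundary_of_pairs {w : Fin 6 → ℂ} (h : nsq w = 1) (h0 : w 0 * w 5 = 0)
    (h1 : w 1 * w 4 = 0) (h2 : w 2 * w 3 = 0) : mu w ∈ hypersimplexBoundary := by
  refine ⟨mu_mem h, ?_⟩
  unfold nsq at h
  rcases mul_eq_zero.1 h0 with a | a <;> rcases mul_eq_zero.1 h1 with b | b <;>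
    rcases mul_eq_zero.1 h2 with c | c <;>
    simp [a, b, c] at h <;>
    simp [Fin.exists_fin_succ, mu, a, b, c, h]

lemma pairs_of_boundary {w : Fin 6 → ℂ} (h : nsq w = 1) (hb : mu w ∈ hypersimplexBoundary) :
    w 0 * w 5 = 0 ∧ w 1 * w 4 = 0 ∧ w 2 * w 3 = 0 := by
  have h0 := sq_nonneg ‖w 0‖
  have h1 := sq_nonneg ‖w 1‖
  have h2 := sq_nonneg ‖w 2‖
  have h3 := sq_nonneg ‖w 3‖
  have h4 := sq_nonneg ‖w 4‖
  have h5 := sq_nonneg ‖w 5‖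
  have z : ∀ k, ‖w k‖ ^ 2 = 0 → w k = 0 := fun k hk => by simpa using hk
  obtain ⟨-, i, hi⟩ := hb
  unfold nsq at h
  have : (‖w 0‖ ^ 2 = 0 ∨ ‖w 5‖ ^ 2 = 0) ∧ (‖w 1‖ ^ 2 = 0 ∨ ‖w 4‖ ^ 2 = 0) ∧
      (‖w 2‖ ^ 2 = 0 ∨ ‖w 3‖ ^ 2 = 0) := by
    fin_cases i <;> rcases hi with hi | hi <;> simp [mu, -pow_eq_zero_iff] at hi <;>
      refine ⟨?_, ?_, ?_⟩ <;> first | (left; linarith) | (right; linarith)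
  obtain ⟨a, b, c⟩ := this
  exact ⟨mul_eq_zero.2 (a.imp (z _) (z _)), mul_eq_zero.2 (b.imp (z _) (z _)),
    mul_eq_zero.2 (c.imp (z _) (z _))⟩

/-- Existence: every `(x, c)` is hit. -/
lemma exists_point {x : Fin 4 → ℝ} (hx : x ∈ hypersimplex) {c : Fin 2 → ℂ} (hc : nsq2 c = 1) :
    ∃ w : Fin 6 → ℂ, (w, c) ∈ corr ∧ mu w = x := by
  obtain ⟨hb, hs⟩ := hx
  obtain ⟨l0, u0⟩ := hb 0
  obtain ⟨l1, u1⟩ := hb 1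
  obtain ⟨l2, u2⟩ := hb 2
  obtain ⟨l3, u3⟩ := hb 3
  set d1 := x 0 + x 1 - 1 with hd1
  set d2 := x 0 + x 2 - 1 with hd2
  set d3 := x 0 + x 3 - 1 with hd3
  let f : ℝ → ℝ := fun s => Real.sqrt (d1 ^ 2 + 4 * ‖(s : ℂ) * c 0‖ ^ 2) +
    Real.sqrt (d2 ^ 2 + 4 * ‖(s : ℂ) * c 1‖ ^ 2) +
    Real.sqrt (d3 ^ 2 + 4 * ‖(s : ℂ) * (c 1 - c 0)‖ ^ 2)
  have hf : Continuous f := by fun_prop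
  have f0 : f 0 ≤ 1 := by
    simp only [f, Complex.ofReal_zero, zero_mul, norm_zero]
    norm_num [Real.sqrt_sq_eq_abs]
    rcases abs_cases d1 with h | h <;> rcases abs_cases d2 with h' | h' <;>
      rcases abs_cases d3 with h'' | h'' <;> linarith
  have f1 : 1 ≤ f 1 := by
    have e1 : 2 * ‖c 0‖ ≤ Real.sqrt (d1 ^ 2 + 4 * ‖c 0‖ ^ 2) := by
      apply Real.le_sqrt_of_sq_le; nlinarith [sq_nonneg d1]
    have e2 : 2 * ‖c 1‖ ≤ Real.sqrt (d2 ^ 2 + 4 * ‖c 1‖ ^ 2) := by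
      apply Real.le_sqrt_of_sq_le; nlinarith [sq_nonneg d2]
    have e3 := Real.sqrt_nonneg (d3 ^ 2 + 4 * ‖c 1 - c 0‖ ^ 2)
    have e4 : 1 ≤ ‖c 0‖ + ‖c 1‖ := by
      unfold nsq2 at hc
      nlinarith [norm_nonneg (c 0), norm_nonneg (c 1),
        mul_nonneg (norm_nonneg (c 0)) (norm_nonneg (c 1))]
    simp only [f, Complex.ofReal_one, one_mul]
    linarith
  obtain ⟨s, -, hfs⟩ := intermediate_value_Icc (zero_le_one' ℝ) hf.continuousOn ⟨f0, f1⟩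
  have key : ∀ (d : ℝ) (z : ℂ), ∃ u v : ℂ, ‖u‖ ^ 2 = (Real.sqrt (d ^ 2 + 4 * ‖z‖ ^ 2) + d) / 2 ∧
      ‖v‖ ^ 2 = (Real.sqrt (d ^ 2 + 4 * ‖z‖ ^ 2) - d) / 2 ∧ u * v = z := by
    intro d z
    have h1 : |d| ≤ Real.sqrt (d ^ 2 + 4 * ‖z‖ ^ 2) := by
      apply Real.le_sqrt_of_sq_le; rw [sq_abs]; nlinarith [sq_nonneg ‖z‖]
    have h2 := abs_le.1 h1
    apply exists_factor
    · linarith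
    · linarith
    · have := Real.sq_sqrt (show 0 ≤ d ^ 2 + 4 * ‖z‖ ^ 2 by positivity)
      linear_combination this / 4
  obtain ⟨w0, w5, a0, a5, p0⟩ := key d1 ((s : ℂ) * c 0)
  obtain ⟨w1, w4, a1, a4, p1⟩ := key d2 ((s : ℂ) * c 1)
  obtain ⟨w2, w3, a2, a3, p2⟩ := key d3 ((s : ℂ) * (c 1 - c 0))
  refine ⟨![w0, w1, w2, w3, w4, w5], ⟨?_, hc, ?_, ?_⟩, ?_⟩
  · simp only [f] at hfs
    simp [nsq]
    linarith
  · simp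
    rw [p0, p1, p2]; ring
  · simp
    rw [p0, p1]; ring
  · simp only [f] at hfs
    funext i
    fin_cases i <;> simp [mu] <;> linarith

open ComplexConjugate in
/-- Fibre comparison. -/
lemma fiber_iff {g g' : (Fin 6 → ℂ) × (Fin 2 → ℂ)} (hg : g ∈ corr) (hg' : g' ∈ corr) :
    ((∀ k, ‖g.1 k‖ = ‖g'.1 k‖) ∧
      g.1 0 * g.1 5 * conj (g.1 1 * g.1 4) = g'.1 0 * g'.1 5 * conj (g'.1 1 * g'.1 4)) ↔
    (mu g.1 = mu g'.1 ∧ (mu g.1 ∈ hypersimplexBoundary ∨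
      ∃ u : ℂ, ‖u‖ = 1 ∧ ∀ k, g'.2 k = u * g.2 k)) := by
  obtain ⟨l, p0, p1, p2⟩ := corr_lambda hg
  obtain ⟨l', p0', p1', p2'⟩ := corr_lambda hg'
  constructor
  · rintro ⟨hn, hz⟩
    refine ⟨by simp [mu, hn], ?_⟩
    by_cases hl : l = 0
    · left
      apply boundary_of_pairs hg.1 <;> simp [p0, p1, p2, hl]
    by_cases hl' : l' = 0
    · left
      have : mu g.1 = mu g'.1 := by simp [mu, hn]
      rw [this]
      apply boundary_of_pairs hg'.1 <;> simp [p0', p1', p2', hl']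
    right
    obtain ⟨u, hu, q0, q1⟩ := exists_unit_of_herm (by simp [hn]) (by simp [hn]) hz
    rw [p0, p0'] at q0
    rw [p1, p1'] at q1
    have r : ∀ k, g'.2 k = u * l / l' * g.2 k := by
      intro k
      fin_cases k <;> simp <;> field_simp
      · linear_combination q0
      · linear_combination q1
    refine ⟨u * l / l', ?_, r⟩
    have h1 := hg.2.1
    have h2 := hg'.2.1
    have : nsq2 g'.2 = ‖u * l / l'‖ ^ 2 * nsq2 g.2 := by
      rw [← nsq2_smul]; congr 1; funext k; exact r k
    rw [h1, h2, mul_one] at this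
    nlinarith [norm_nonneg (u * l / l')]
  · rintro ⟨hm, hor⟩
    have m0 := congrFun hm 0
    have m1 := congrFun hm 1
    have m2 := congrFun hm 2
    have m3 := congrFun hm 3
    simp [mu] at m0 m1 m2 m3
    have s := hg.1
    have s' := hg'.1
    unfold nsq at s s'
    have uniq : ∀ (v v' : Fin 6 → ℂ), (‖v 0‖ ^ 2 - ‖v 5‖ ^ 2 = ‖v' 0‖ ^ 2 - ‖v' 5‖ ^ 2) →
        (‖v 1‖ ^ 2 - ‖v 4‖ ^ 2 = ‖v' 1‖ ^ 2 - ‖v' 4‖ ^ 2) →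
        (‖v 2‖ ^ 2 - ‖v 3‖ ^ 2 = ‖v' 2‖ ^ 2 - ‖v' 3‖ ^ 2) → nsq v = nsq v' →
        ‖v 0 * v 5‖ ≤ ‖v' 0 * v' 5‖ → ‖v 1 * v 4‖ ≤ ‖v' 1 * v' 4‖ →
        ‖v 2 * v 3‖ ≤ ‖v' 2 * v' 3‖ → ∀ k, ‖v k‖ = ‖v' k‖ := by
      intro v v' d1 d2 d3 hs h1 h2 h3 k
      have q1 := pow_le_pow_left₀ (norm_nonneg _) h1 2
      have q2 := pow_le_pow_left₀ (norm_nonneg _) h2 2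
      have q3 := pow_le_pow_left₀ (norm_nonneg _) h3 2
      rw [norm_mul, norm_mul, mul_pow, mul_pow] at q1 q2 q3
      have := moduli_unique (a := fun k => ‖v k‖ ^ 2) (a' := fun k => ‖v' k‖ ^ 2)
        (fun _ => sq_nonneg _) d1 d2 d3 hs q1 q2 q3 k
      exact (pow_left_inj₀ (norm_nonneg _) (norm_nonneg _) (by norm_num)).1 this
    rcases hor with hb | ⟨u, hu, hr⟩
    · obtain ⟨b0, b1, b2⟩ := pairs_of_boundary hg.1 hb
      obtain ⟨b0', b1', b2'⟩ := pairs_of_boundary hg'.1 (hm ▸ hb)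
      refine ⟨uniq _ _ (by linarith) (by linarith) (by linarith) (hg.1.trans hg'.1.symm)
        ?_ ?_ ?_, by simp [b0, b0']⟩
      · rw [b0, b0']
      · rw [b1, b1']
      · rw [b2, b2']
    · have t0 : ‖g'.2 0‖ = ‖g.2 0‖ := by rw [hr, norm_mul, hu, one_mul]
      have t1 : ‖g'.2 1‖ = ‖g.2 1‖ := by rw [hr, norm_mul, hu, one_mul]
      have t2 : ‖g'.2 1 - g'.2 0‖ = ‖g.2 1 - g.2 0‖ := by
        rw [hr, hr, ← mul_sub, norm_mul, hu, one_mul]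
      have hn : ∀ k, ‖g.1 k‖ = ‖g'.1 k‖ := by
        rcases le_total ‖l‖ ‖l'‖ with hl | hl
        · apply uniq _ _ (by linarith) (by linarith) (by linarith) (hg.1.trans hg'.1.symm)
          · rw [p0, p0', norm_mul, norm_mul, t0]; gcongr
          · rw [p1, p1', norm_mul, norm_mul, t1]; gcongr
          · rw [p2, p2', norm_mul, norm_mul, t2]; gcongr
        · intro k
          symm
          revert k
          apply uniq _ _ (by linarith) (by linarith) (by linarith) (hg'.1.trans hg.1.symm)
          · rw [p0, p0', norm_mul, norm_mul, t0]; gcongr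
          · rw [p1, p1', norm_mul, norm_mul, t1]; gcongr
          · rw [p2, p2', norm_mul, norm_mul, t2]; gcongr
      refine ⟨hn, ?_⟩
      have e0 : ‖l‖ * ‖g.2 0‖ = ‖l'‖ * ‖g.2 0‖ := by
        rw [← t0, ← norm_mul l', ← p0', t0, ← norm_mul, ← p0]; simp [hn]
      have e1 : ‖l‖ * ‖g.2 1‖ = ‖l'‖ * ‖g.2 1‖ := by
        rw [← t1, ← norm_mul l', ← p1', t1, ← norm_mul, ← p1]; simp [hn]
      have hl : ‖l‖ = ‖l'‖ := by
        by_cases h : g.2 0 = 0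
        · have h1 : g.2 1 ≠ 0 := by
            intro h1
            have := hg.2.1
            simp [nsq2, h, h1] at this
          exact mul_right_cancel₀ (norm_ne_zero_iff.2 h1) e1
        · exact mul_right_cancel₀ (norm_ne_zero_iff.2 h) e0
      have hl2 : l * conj l = l' * conj l' := by
        rw [Complex.mul_conj', Complex.mul_conj', hl]
      have hu2 : u * conj u = 1 := by
        rw [Complex.mul_conj', hu]; simp
      rw [p0, p1, p0', p1', hr, hr]
      simp only [map_mul]
      linear_combination g.2 0 * conj (g.2 1) * hl2 -
        l' * conj l' * g.2 0 * conj (g.2 1) * hu2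

lemma homeo_of_corr {G A B : Type*} [TopologicalSpace G] [TopologicalSpace A] [TopologicalSpace B]
    [CompactSpace G] [T2Space A] [T2Space B] (a : G → A) (b : G → B) (ha : Continuous a)
    (hb : Continuous b) (sa : Function.Surjective a) (sb : Function.Surjective b)
    (h : ∀ g g', a g = a g' ↔ b g = b g') : Nonempty (A ≃ₜ B) := by
  have qa : Topology.IsQuotientMap (⟨a, ha⟩ : C(G, A)) :=
    Topology.IsQuotientMap.of_surjective_continuous sa ha
  have qb : Topology.IsQuotientMap (⟨b, hb⟩ : C(G, B)) :=
    Topology.IsQuotientMap.of_surjective_continuous sb hb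
  refine ⟨{ toFun := qa.lift ⟨b, hb⟩ (fun g g' e => (h g g').1 e)
            invFun := qb.lift ⟨a, ha⟩ (fun g g' e => (h g g').2 e)
            left_inv := ?_
            right_inv := ?_
            continuous_toFun := ContinuousMap.continuous _
            continuous_invFun := ContinuousMap.continuous _ }⟩
  · intro x
    obtain ⟨g, rfl⟩ := sa x
    have e1 : qa.lift ⟨b, hb⟩ (fun g g' e => (h g g').1 e) (a g) = b g :=
      DFunLike.congr_fun (qa.lift_comp ⟨b, hb⟩ (fun g g' e => (h g g').1 e)) g
    have e2 : qb.lift ⟨a, ha⟩ (fun g g' e => (h g g').2 e) (b g) = a g :=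
      DFunLike.congr_fun (qb.lift_comp ⟨a, ha⟩ (fun g g' e => (h g g').2 e)) g
    rw [e1, e2]
  · intro x
    obtain ⟨g, rfl⟩ := sb x
    have e1 : qa.lift ⟨b, hb⟩ (fun g g' e => (h g g').1 e) (a g) = b g :=
      DFunLike.congr_fun (qa.lift_comp ⟨b, hb⟩ (fun g g' e => (h g g').1 e)) g
    have e2 : qb.lift ⟨a, ha⟩ (fun g g' e => (h g g').2 e) (b g) = a g :=
      DFunLike.congr_fun (qb.lift_comp ⟨a, ha⟩ (fun g g' e => (h g g').2 e)) g
    rw [e2, e1]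

lemma continuous_nsq : Continuous nsq := by unfold nsq; fun_prop

lemma continuous_nsq2 : Continuous nsq2 := by unfold nsq2; fun_prop

lemma continuous_mu : Continuous mu := by
  refine continuous_pi fun i => ?_
  fin_cases i <;> simp [mu] <;> fun_prop

lemma isCompact_corr : IsCompact corr := by
  apply Metric.isCompact_of_isClosed_isBounded
  · have c1 := continuous_nsq
    have c2 := continuous_nsq2
    refine IsClosed.inter (isClosed_eq (by fun_prop) (by fun_prop)) ?_
    refine IsClosed.inter (isClosed_eq (by fun_prop) (by fun_prop)) ?_
    exact IsClosed.inter (isClosed_eq (by fun_prop) (by fun_prop))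
      (isClosed_eq (by fun_prop) (by fun_prop))
  · refine (Metric.isBounded_closedBall (x := 0) (r := 1)).subset ?_
    rintro ⟨w, c⟩ ⟨h1, h2, -⟩
    simp only [nsq, nsq2] at h1 h2
    rw [mem_closedBall_zero_iff, Prod.norm_def, max_le_iff]
    have key : ∀ r : ℝ, r ^ 2 ≤ 1 → r ≤ 1 := fun r hr => by nlinarith
    have h0 := fun k => sq_nonneg ‖w k‖
    have h0' := fun k => sq_nonneg ‖c k‖
    have a0 := h0 0
    have a1 := h0 1
    have a2 := h0 2
    have a3 := h0 3
    have a4 := h0 4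
    have a5 := h0 5
    have b0 := h0' 0
    have b1 := h0' 1
    constructor
    · rw [pi_norm_le_iff_of_nonneg zero_le_one]
      intro k
      apply key
      fin_cases k <;> simp only [Fin.zero_eta, Fin.mk_one, Fin.reduceFinMk] <;> linarith
    · rw [pi_norm_le_iff_of_nonneg zero_le_one]
      intro k
      apply key
      fin_cases k <;> simp only [Fin.zero_eta, Fin.mk_one] <;> linarith

open ComplexConjugate in
/-- Torus invariants of a nonzero vector. -/
noncomputable def invVec (w : {w : Fin 6 → ℂ // w ≠ 0}) : (Fin 6 → ℝ) × ℂ :=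
  (fun k => ‖w.1 k‖ ^ 2 / nsq w.1,
    w.1 0 * w.1 5 * conj (w.1 1 * w.1 4) / ((nsq w.1 : ℝ) : ℂ) ^ 2)

open ComplexConjugate in
lemma invVec_scale {w w' : {w : Fin 6 → ℂ // w ≠ 0}} (h : projRel w w') :
    invVec w = invVec w' := by
  obtain ⟨c, hc, h⟩ := h
  have hn := nsq_smul c w.1
  rw [h] at hn
  have hc' : ‖c‖ ≠ 0 := norm_ne_zero_iff.2 hc
  have hp := (nsq_pos w.2).ne'
  have hpc : ((nsq w.1 : ℝ) : ℂ) ≠ 0 := by exact_mod_cast hp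
  have hcc : ((‖c‖ : ℝ) : ℂ) ≠ 0 := by exact_mod_cast hc'
  have hk : ∀ k, w'.1 k = c * w.1 k := fun k => (congrFun h k).symm
  unfold invVec
  rw [hn]
  refine Prod.ext ?_ ?_
  · funext k
    simp only [hk, norm_mul]
    field_simp
  · simp only [hk, map_mul]
    push_cast
    have hcj : c * conj c = (‖c‖ : ℂ) ^ 2 := Complex.mul_conj' c
    rw [← hcj]
    have : conj c ≠ 0 := (map_ne_zero _).2 hc
    field_simp

/-- Torus invariants on projective space. -/
noncomputable def invCP5 : CP5 → (Fin 6 → ℝ) × ℂ :=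
  Quot.lift invVec fun _ _ h => invVec_scale h

lemma continuous_invCP5 : Continuous invCP5 := by
  apply continuous_quot_lift
  have c1 := continuous_nsq
  unfold invVec
  have hp : ∀ w : {w : Fin 6 → ℂ // w ≠ 0}, nsq w.1 ≠ 0 := fun w => (nsq_pos w.2).ne'
  have hv : ∀ k, Continuous fun w : {w : Fin 6 → ℂ // w ≠ 0} => w.1 k :=
    fun k => (continuous_apply k).comp continuous_subtype_val
  have hpc : ∀ w : {w : Fin 6 → ℂ // w ≠ 0}, ((nsq w.1 : ℝ) : ℂ) ^ 2 ≠ 0 :=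
    fun w => pow_ne_zero _ (by exact_mod_cast hp w)
  refine Continuous.prodMk (continuous_pi fun k => ?_) ?_
  · exact Continuous.div ((hv k).norm.pow 2) (by fun_prop) hp
  · exact Continuous.div (((hv 0).mul (hv 5)).mul
      (Complex.continuous_conj.comp ((hv 1).mul (hv 4)))) (by fun_prop) hpc

lemma norm_torusCoef {t : Fin 4 → ℂ} (ht : ∀ i, ‖t i‖ = 1) (k : Fin 6) :
    ‖torusCoef t k‖ = 1 := by
  fin_cases k <;> simp [torusCoef, ht]

open ComplexConjugate in
lemma invVec_torus {w w' : {w : Fin 6 → ℂ // w ≠ 0}} {t : Fin 4 → ℂ} (ht : ∀ i, ‖t i‖ = 1)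
    (h : ∀ k : Fin 6, w'.1 k = torusCoef t k * w.1 k) : invVec w = invVec w' := by
  have hn : ∀ k, ‖w'.1 k‖ = ‖w.1 k‖ := fun k => by
    rw [h, norm_mul, norm_torusCoef ht, one_mul]
  have hN : nsq w'.1 = nsq w.1 := by simp [nsq, hn]
  have hz : w'.1 0 * w'.1 5 * conj (w'.1 1 * w'.1 4) =
      w.1 0 * w.1 5 * conj (w.1 1 * w.1 4) := by
    have e : ∀ i, t i * conj (t i) = 1 := fun i => by rw [Complex.mul_conj', ht]; simp
    have e4 : t 0 * t 1 * t 2 * t 3 * conj (t 0 * t 1 * t 2 * t 3) = 1 := by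
      rw [Complex.mul_conj']; simp [ht]
    simp only [map_mul] at e4
    rw [h, h, h, h]
    simp [torusCoef]
    linear_combination (w.1 0 * w.1 5 * (conj (w.1 1) * conj (w.1 4))) * e4
  unfold invVec
  rw [hN, hz]
  simp only [hn]

/-- The invariants on the orbit space. -/
noncomputable def invA : Quot orbitRel → (Fin 6 → ℝ) × ℂ :=
  Quot.lift (fun p => invCP5 p.1) (by
    rintro p q ⟨t, ht, w, w', hw, hw', h⟩
    rw [← hw, ← hw']
    exact invVec_torus ht h)

lemma continuous_invA : Continuous invA :=
  continuous_quot_lift _ (continuous_invCP5.comp continuous_subtype_val)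

/-- First leg of the correspondence. -/
def legA (g : corr) : Quot orbitRel :=
  Quot.mk _ ⟨Quot.mk _ ⟨g.1.1, ne_zero_of_nsq g.2.1⟩, ⟨_, rfl, g.2.2.2.1⟩⟩

lemma continuous_legA : Continuous legA := by
  apply continuous_quot_mk.comp
  apply Continuous.subtype_mk
  apply continuous_quot_mk.comp
  apply Continuous.subtype_mk
  fun_prop

lemma surjective_legA : Function.Surjective legA := by
  rintro ⟨⟨p, w, rfl, hw⟩⟩
  obtain ⟨k, hk, hkn⟩ := exists_scale (nsq_pos w.2)
  obtain ⟨c, hc, hcw⟩ : ∃ c : Fin 2 → ℂ, nsq2 c = 1 ∧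
      w.1 0 * w.1 5 * c 1 = w.1 1 * w.1 4 * c 0 := by
    by_cases h : (![w.1 0 * w.1 5, w.1 1 * w.1 4] : Fin 2 → ℂ) = 0
    · have h0 := congrFun h 0
      have h1 := congrFun h 1
      simp only [Matrix.cons_val_zero, Matrix.cons_val_one, Pi.zero_apply] at h0 h1
      exact ⟨![1, 0], by simp [nsq2], by rw [h0, h1]; simp⟩
    · obtain ⟨m, hm, hmn⟩ := exists_scale (nsq2_pos h)
      refine ⟨_, (nsq2_smul m _).trans hmn, ?_⟩
      simp
      ring
  refine ⟨⟨(fun j => k * w.1 j, c), (nsq_smul k _).trans hkn, hc, ?_, ?_⟩, ?_⟩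
  · linear_combination k ^ 2 * hw
  · linear_combination k ^ 2 * hcw
  · apply congrArg (Quot.mk orbitRel)
    apply Subtype.ext
    exact (Quot.sound ⟨k, hk, rfl⟩).symm

open ComplexConjugate in
lemma legA_eq_of {g g' : corr} (h : (∀ k, ‖g.1.1 k‖ = ‖g'.1.1 k‖) ∧
      g.1.1 0 * g.1.1 5 * conj (g.1.1 1 * g.1.1 4) =
        g'.1.1 0 * g'.1.1 5 * conj (g'.1.1 1 * g'.1.1 4)) : legA g = legA g' := by
  obtain ⟨t, ht, hk⟩ := exists_torus g.2.2.2.1 g'.2.2.2.1 h.1 h.2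
  exact Quot.sound ⟨t, ht, _, _, rfl, rfl, hk⟩

open ComplexConjugate in
lemma of_invA_eq {g g' : corr} (h : invA (legA g) = invA (legA g')) :
    (∀ k, ‖g.1.1 k‖ = ‖g'.1.1 k‖) ∧
      g.1.1 0 * g.1.1 5 * conj (g.1.1 1 * g.1.1 4) =
        g'.1.1 0 * g'.1.1 5 * conj (g'.1.1 1 * g'.1.1 4) := by
  change invVec ⟨g.1.1, _⟩ = invVec ⟨g'.1.1, _⟩ at h
  simp only [invVec, g.2.1, g'.2.1, Prod.mk.injEq] at h
  obtain ⟨h1, h2⟩ := h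
  constructor
  · intro k
    have := congrFun h1 k
    simp only [div_one] at this
    exact (pow_left_inj₀ (norm_nonneg _) (norm_nonneg _) (by norm_num)).1 this
  · simpa using h2

lemma injective_invA : Function.Injective invA := by
  intro x y h
  obtain ⟨g, rfl⟩ := surjective_legA x
  obtain ⟨g', rfl⟩ := surjective_legA y
  exact legA_eq_of (of_invA_eq h)

open ComplexConjugate in
/-- Invariants of a nonzero vector of `ℂ²` up to scaling. -/
noncomputable def invVec2 (c : {w : Fin 2 → ℂ // w ≠ 0}) : ℝ × ℝ × ℂ :=
  (‖c.1 0‖ ^ 2 / nsq2 c.1, ‖c.1 1‖ ^ 2 / nsq2 c.1, c.1 0 * conj (c.1 1) / ((nsq2 c.1 : ℝ) : ℂ))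

open ComplexConjugate in
lemma invVec2_scale {w w' : {w : Fin 2 → ℂ // w ≠ 0}} (h : projRel1 w w') :
    invVec2 w = invVec2 w' := by
  obtain ⟨c, hc, h⟩ := h
  have hn := nsq2_smul c w.1
  rw [h] at hn
  have hc' : ‖c‖ ≠ 0 := norm_ne_zero_iff.2 hc
  have hp := (nsq2_pos w.2).ne'
  have hpc : ((nsq2 w.1 : ℝ) : ℂ) ≠ 0 := by exact_mod_cast hp
  have hcc : ((‖c‖ : ℝ) : ℂ) ≠ 0 := by exact_mod_cast hc'
  have hk : ∀ k, w'.1 k = c * w.1 k := fun k => (congrFun h k).symm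
  unfold invVec2
  rw [hn]
  refine Prod.ext ?_ (Prod.ext ?_ ?_)
  · simp only [hk, norm_mul]
    field_simp
  · simp only [hk, norm_mul]
    field_simp
  · simp only [hk, map_mul]
    push_cast
    have hcj : c * conj c = (‖c‖ : ℂ) ^ 2 := Complex.mul_conj' c
    rw [← hcj]
    have : conj c ≠ 0 := (map_ne_zero _).2 hc
    field_simp

/-- Invariants on `ℂP¹`. -/
noncomputable def invCP1 : CP1 → ℝ × ℝ × ℂ :=
  Quot.lift invVec2 fun _ _ h => invVec2_scale h

lemma continuous_invCP1 : Continuous invCP1 := by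
  apply continuous_quot_lift
  have c1 := continuous_nsq2
  unfold invVec2
  have hp : ∀ w : {w : Fin 2 → ℂ // w ≠ 0}, nsq2 w.1 ≠ 0 := fun w => (nsq2_pos w.2).ne'
  have hv : ∀ k, Continuous fun w : {w : Fin 2 → ℂ // w ≠ 0} => w.1 k :=
    fun k => (continuous_apply k).comp continuous_subtype_val
  have hpc : ∀ w : {w : Fin 2 → ℂ // w ≠ 0}, ((nsq2 w.1 : ℝ) : ℂ) ≠ 0 :=
    fun w => by exact_mod_cast hp w
  refine Continuous.prodMk ?_ (Continuous.prodMk ?_ ?_)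
  · exact Continuous.div ((hv 0).norm.pow 2) (by fun_prop) hp
  · exact Continuous.div ((hv 1).norm.pow 2) (by fun_prop) hp
  · exact Continuous.div ((hv 0).mul (Complex.continuous_conj.comp (hv 1))) (by fun_prop) hpc

/-- A function vanishing exactly on the boundary. -/
def bdry (x : Fin 4 → ℝ) : ℝ := ∏ i, (x i * (1 - x i))

lemma bdry_eq_zero {x : Fin 4 → ℝ} (hx : x ∈ hypersimplex) :
    bdry x = 0 ↔ x ∈ hypersimplexBoundary := by
  unfold bdry
  rw [Finset.prod_eq_zero_iff]
  constructor
  · rintro ⟨i, -, hi⟩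
    refine ⟨hx, i, ?_⟩
    rcases mul_eq_zero.1 hi with h | h
    · exact Or.inl h
    · right; linarith
  · rintro ⟨-, i, hi⟩
    refine ⟨i, Finset.mem_univ _, ?_⟩
    rcases hi with h | h <;> simp [h]

/-- Invariants on the glued space. -/
noncomputable def invB : Quot glueRel → (Fin 4 → ℝ) × (ℝ × ℝ × ℂ) :=
  Quot.lift (fun p => (p.1.1, bdry p.1.1 • invCP1 p.2)) (by
    rintro p q (rfl | ⟨h, hb⟩)
    · rfl
    · have h0 := (bdry_eq_zero p.1.2).2 hb
      simp only [← h, h0, zero_smul])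

lemma continuous_invB : Continuous invB := by
  apply continuous_quot_lift
  have c1 := continuous_invCP1
  have c2 : Continuous bdry := by unfold bdry; fun_prop
  have c3 : Continuous fun p : ↥hypersimplex × CP1 => (p.1 : Fin 4 → ℝ) :=
    continuous_subtype_val.comp continuous_fst
  exact c3.prodMk ((c2.comp c3).smul (c1.comp continuous_snd))

/-- Second leg of the correspondence. -/
noncomputable def legB (g : corr) : Quot glueRel :=
  Quot.mk _ (⟨mu g.1.1, mu_mem g.2.1⟩, Quot.mk _ ⟨g.1.2, ne_zero_of_nsq2 g.2.2.1⟩)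

lemma continuous_legB : Continuous legB := by
  apply continuous_quot_mk.comp
  refine Continuous.prodMk ?_ ?_
  · exact Continuous.subtype_mk (continuous_mu.comp (by fun_prop)) _
  · apply continuous_quot_mk.comp
    apply Continuous.subtype_mk
    fun_prop

lemma surjective_legB : Function.Surjective legB := by
  rintro ⟨⟨⟨x, hx⟩, ⟨c⟩⟩⟩
  obtain ⟨k, hk, hkn⟩ := exists_scale (nsq2_pos c.2)
  obtain ⟨w, hw, rfl⟩ := exists_point hx ((nsq2_smul k _).trans hkn)
  refine ⟨⟨_, hw⟩, ?_⟩
  apply congrArg (Quot.mk glueRel)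
  refine Prod.ext rfl ?_
  exact (Quot.sound ⟨k, hk, rfl⟩).symm

lemma legB_eq_of {g g' : corr} (h : mu g.1.1 = mu g'.1.1 ∧ (mu g.1.1 ∈ hypersimplexBoundary ∨
      ∃ u : ℂ, ‖u‖ = 1 ∧ ∀ k, g'.1.2 k = u * g.1.2 k)) : legB g = legB g' := by
  obtain ⟨h1, h2⟩ := h
  apply Quot.sound
  rcases h2 with hb | ⟨u, hu, hk⟩
  · exact Or.inr ⟨Subtype.ext h1, hb⟩
  · left
    refine Prod.ext (Subtype.ext h1) ?_
    exact Quot.sound ⟨u, by rintro rfl; simp at hu, (funext hk).symm⟩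

lemma of_invB_eq {g g' : corr} (h : invB (legB g) = invB (legB g')) :
    mu g.1.1 = mu g'.1.1 ∧ (mu g.1.1 ∈ hypersimplexBoundary ∨
      ∃ u : ℂ, ‖u‖ = 1 ∧ ∀ k, g'.1.2 k = u * g.1.2 k) := by
  have h1 : mu g.1.1 = mu g'.1.1 := congrArg Prod.fst h
  have h2 : bdry (mu g.1.1) • invVec2 ⟨g.1.2, ne_zero_of_nsq2 g.2.2.1⟩ =
      bdry (mu g'.1.1) • invVec2 ⟨g'.1.2, ne_zero_of_nsq2 g'.2.2.1⟩ := congrArg Prod.snd h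
  refine ⟨h1, ?_⟩
  by_cases hb : mu g.1.1 ∈ hypersimplexBoundary
  · exact Or.inl hb
  right
  have hb0 := mt (bdry_eq_zero (mu_mem g.2.1)).1 hb
  rw [← h1] at h2
  have h3 := smul_right_injective _ hb0 h2
  simp only [invVec2, g.2.2.1, g'.2.2.1, Prod.mk.injEq, div_one, Complex.ofReal_one] at h3
  obtain ⟨e0, e1, e2⟩ := h3
  obtain ⟨u, hu, q0, q1⟩ := exists_unit_of_herm
    ((pow_left_inj₀ (norm_nonneg _) (norm_nonneg _) (by norm_num)).1 e0)
    ((pow_left_inj₀ (norm_nonneg _) (norm_nonneg _) (by norm_num)).1 e1) e2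
  refine ⟨u, hu, fun k => ?_⟩
  fin_cases k
  · exact q0
  · exact q1

lemma injective_invB : Function.Injective invB := by
  intro x y h
  obtain ⟨g, rfl⟩ := surjective_legB x
  obtain ⟨g', rfl⟩ := surjective_legB y
  exact legB_eq_of (of_invB_eq h)

/-- the orbit space `G₄,₂/T⁴` is homeomorphic to
`(Δ₄,₂ × ℂP¹)/≈`, where `≈` collapses the `ℂP¹`-factor over each boundary point of the
octahedron `Δ₄,₂`. -/
theorem orbitSpace_homeomorph_glued_product :
    Nonempty (Quot orbitRel ≃ₜ Quot glueRel) := by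
  
  have : CompactSpace corr := isCompact_iff_compactSpace.1 isCompact_corr
  have : T2Space (Quot orbitRel) := T2Space.of_injective_continuous injective_invA continuous_invA
  have : T2Space (Quot glueRel) := T2Space.of_injective_continuous injective_invB continuous_invB
  refine homeo_of_corr legA legB continuous_legA continuous_legB surjective_legA surjective_legB ?_
  intro g g'
  constructor
  · intro h
    exact legB_eq_of ((fiber_iff g.2 g'.2).1 (of_invA_eq (congrArg invA h)))
  · intro h
    exact legA_eq_of ((fiber_iff g.2 g'.2).2 (of_invB_eq (congrArg invB h)))
end

section
/- The orbit space X/T⁴ of the canonical T⁴-action on the Grassmannian G₄,₂ (realized as the Plücker quadric X) is homeomorphic to the 5-dimensional sphere S⁵, i.e. to the unit sphere {x ∈ ℝ⁶ : ‖x‖ = 1}. -/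
open Complex ComplexConjugate

namespace OrbitSphere

lemma real_pair_inj {x y x' y' : ℝ} (hx : 0 ≤ x) (hy : 0 ≤ y) (hx' : 0 ≤ x') (hy' : 0 ≤ y')
    (h1 : x * y = x' * y') (h2 : x ^ 2 - y ^ 2 = x' ^ 2 - y' ^ 2) : x' = x ∧ y' = y := by
  have h3 : (x ^ 2 + y ^ 2) ^ 2 = (x' ^ 2 + y' ^ 2) ^ 2 := by
    have e1 : (x ^ 2 + y ^ 2) ^ 2 = (x ^ 2 - y ^ 2) ^ 2 + 4 * (x * y) ^ 2 := by ring
    have e2 : (x' ^ 2 + y' ^ 2) ^ 2 = (x' ^ 2 - y' ^ 2) ^ 2 + 4 * (x' * y') ^ 2 := by ring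
    rw [e1, e2, h1, h2]
  have h4 : x ^ 2 + y ^ 2 = x' ^ 2 + y' ^ 2 :=
    (pow_left_inj₀ (by positivity) (by positivity) two_ne_zero).1 h3
  constructor
  · exact (pow_left_inj₀ hx' hx two_ne_zero).1 (by linarith)
  · exact (pow_left_inj₀ hy' hy two_ne_zero).1 (by linarith)

/-- Two pairs with the same invariants differ by phases. -/
lemma pair_inj {z w z' w' p : ℂ} (hp : ‖p‖ = 1) (h1 : z' * w' = p * (z * w))
    (h2 : ‖z'‖ ^ 2 - ‖w'‖ ^ 2 = ‖z‖ ^ 2 - ‖w‖ ^ 2) :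
    ∃ s s' : ℂ, ‖s‖ = 1 ∧ ‖s'‖ = 1 ∧ s * s' = p ∧ z' = s * z ∧ w' = s' * w := by
  have hn : ‖z‖ * ‖w‖ = ‖z'‖ * ‖w'‖ := by
    rw [← norm_mul, ← norm_mul, h1, norm_mul p, hp, one_mul]
  obtain ⟨hz, hw⟩ := real_pair_inj (norm_nonneg z) (norm_nonneg w) (norm_nonneg z')
    (norm_nonneg w') hn h2.symm
  have hp0 : p ≠ 0 := by rintro rfl; simp at hp
  by_cases hz0 : z = 0
  · have hz0' : z' = 0 := by rw [← norm_eq_zero, hz, hz0, norm_zero]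
    by_cases hw0 : w = 0
    · have hw0' : w' = 0 := by rw [← norm_eq_zero, hw, hw0, norm_zero]
      exact ⟨p, 1, hp, by simp, by simp, by simp [hz0, hz0'], by simp [hw0, hw0']⟩
    · have hwn : ‖w‖ ≠ 0 := norm_ne_zero_iff.2 hw0
      have hw0' : w' ≠ 0 := by rw [← norm_ne_zero_iff, hw]; exact hwn
      refine ⟨p * (w / w'), w' / w, ?_, ?_, ?_, ?_, ?_⟩
      · rw [norm_mul, norm_div, hp, hw, div_self hwn, one_mul]
      · rw [norm_div, hw, div_self hwn]
      · field_simp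
      · simp [hz0, hz0']
      · field_simp
  · have hzn : ‖z‖ ≠ 0 := norm_ne_zero_iff.2 hz0
    have hz0' : z' ≠ 0 := by rw [← norm_ne_zero_iff, hz]; exact hzn
    refine ⟨z' / z, p * (z / z'), ?_, ?_, ?_, ?_, ?_⟩
    · rw [norm_div, hz, div_self hzn]
    · rw [norm_mul, norm_div, hp, hz, div_self hzn, one_mul]
    · field_simp
    · field_simp
    · field_simp
      linear_combination h1

lemma pair_surj (u : ℝ) (a : ℂ) : ∃ z w : ℂ, z * w = a ∧ ‖z‖ ^ 2 - ‖w‖ ^ 2 = u := by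
  set R := Real.sqrt (u ^ 2 + 4 * ‖a‖ ^ 2) with hR
  have hR2 : R ^ 2 = u ^ 2 + 4 * ‖a‖ ^ 2 := Real.sq_sqrt (by positivity)
  have hR0 : 0 ≤ R := Real.sqrt_nonneg _
  have hRu : |u| ≤ R := Real.abs_le_sqrt (by nlinarith [norm_nonneg a])
  have hu1 := neg_abs_le u
  have hX : 0 ≤ (R + u) / 2 := by linarith
  rcases hX.eq_or_lt with h0 | hpos
  · have hRu' : R = -u := by linarith
    have ha : a = 0 := by
      rw [← norm_eq_zero, ← pow_eq_zero_iff two_ne_zero]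
      rw [hRu'] at hR2; nlinarith
    refine ⟨0, (Real.sqrt R : ℂ), by simp [ha], ?_⟩
    rw [norm_real, Real.norm_eq_abs, sq_abs, Real.sq_sqrt hR0]
    simp [hRu']
  · have hs : 0 < Real.sqrt ((R + u) / 2) := Real.sqrt_pos.2 hpos
    refine ⟨(Real.sqrt ((R + u) / 2) : ℂ), a / (Real.sqrt ((R + u) / 2) : ℂ), ?_, ?_⟩
    · have : (Real.sqrt ((R + u) / 2) : ℂ) ≠ 0 := by exact_mod_cast hs.ne'
      field_simp
    · rw [norm_div, norm_real, Real.norm_eq_abs, div_pow, sq_abs, Real.sq_sqrt hX]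
      have : R + u ≠ 0 := by linarith
      field_simp
      nlinarith

/-- signed square -/
def ssq (u : ℝ) : ℝ := u * |u|

lemma ssq_inj {u v : ℝ} (h : ssq u = ssq v) : u = v := by
  unfold ssq at h
  rcases le_total 0 u with hu | hu <;> rcases le_total 0 v with hv | hv
  · rw [abs_of_nonneg hu, abs_of_nonneg hv] at h; nlinarith
  · rw [abs_of_nonneg hu, abs_of_nonpos hv] at h
    have h1 : u = 0 := by nlinarith [sq_nonneg u, sq_nonneg v]
    have h2 : v = 0 := by nlinarith [sq_nonneg u, sq_nonneg v]
    rw [h1, h2]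
  · rw [abs_of_nonpos hu, abs_of_nonneg hv] at h
    have h1 : u = 0 := by nlinarith [sq_nonneg u, sq_nonneg v]
    have h2 : v = 0 := by nlinarith [sq_nonneg u, sq_nonneg v]
    rw [h1, h2]
  · rw [abs_of_nonpos hu, abs_of_nonpos hv] at h; nlinarith

lemma ssq_surj (v : ℝ) : ∃ u, ssq u = v := by
  unfold ssq
  rcases le_total 0 v with hv | hv
  · exact ⟨Real.sqrt v, by rw [abs_of_nonneg (Real.sqrt_nonneg _), Real.mul_self_sqrt hv]⟩
  · refine ⟨-Real.sqrt (-v), ?_⟩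
    rw [abs_neg, abs_of_nonneg (Real.sqrt_nonneg _), neg_mul, Real.mul_self_sqrt (by linarith)]
    ring

lemma ssq_mul {c : ℝ} (hc : 0 ≤ c) (u : ℝ) : ssq (c * u) = c ^ 2 * ssq u := by
  unfold ssq; rw [abs_mul, abs_of_nonneg hc]; ring

/-- The degree-four invariant map `ℂ⁶ → ℝ⁶`. -/
noncomputable def F (w : Fin 6 → ℂ) : EuclideanSpace ℝ (Fin 6) :=
  !₂[ssq (‖w 0‖ ^ 2 - ‖w 5‖ ^ 2), ssq (‖w 1‖ ^ 2 - ‖w 4‖ ^ 2), ssq (‖w 2‖ ^ 2 - ‖w 3‖ ^ 2),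
    ((w 0 * w 5) * conj (w 2 * w 3)).re, ((w 0 * w 5) * conj (w 2 * w 3)).im,
    ‖w 0 * w 5‖ ^ 2 - ‖w 2 * w 3‖ ^ 2]

lemma F_cont : Continuous F := by
  unfold F ssq
  refine (PiLp.continuous_toLp 2 _).comp ?_
  refine continuous_pi fun i => ?_
  fin_cases i <;> simp <;> fun_prop

lemma F_eq_iff (w w' : Fin 6 → ℂ) : F w = F w' ↔
    (‖w 0‖ ^ 2 - ‖w 5‖ ^ 2 = ‖w' 0‖ ^ 2 - ‖w' 5‖ ^ 2 ∧
     ‖w 1‖ ^ 2 - ‖w 4‖ ^ 2 = ‖w' 1‖ ^ 2 - ‖w' 4‖ ^ 2 ∧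
     ‖w 2‖ ^ 2 - ‖w 3‖ ^ 2 = ‖w' 2‖ ^ 2 - ‖w' 3‖ ^ 2 ∧
     (w 0 * w 5) * conj (w 2 * w 3) = (w' 0 * w' 5) * conj (w' 2 * w' 3) ∧
     ‖w 0 * w 5‖ ^ 2 - ‖w 2 * w 3‖ ^ 2 = ‖w' 0 * w' 5‖ ^ 2 - ‖w' 2 * w' 3‖ ^ 2) := by
  constructor
  · intro h
    refine ⟨ssq_inj (congrArg (fun v => v 0) h), ssq_inj (congrArg (fun v => v 1) h),
      ssq_inj (congrArg (fun v => v 2) h),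
      Complex.ext (congrArg (fun v => v 3) h) (congrArg (fun v => v 4) h),
      (congrArg (fun v => v 5) h)⟩
  · rintro ⟨h0, h1, h2, h3, h4⟩
    unfold F
    rw [h0, h1, h2, h3, h4]

lemma F_smul (c : ℂ) (w : Fin 6 → ℂ) : F (fun k => c * w k) = (‖c‖ ^ 4) • F w := by
  have key : ∀ x y : ℂ, ssq (‖c * x‖ ^ 2 - ‖c * y‖ ^ 2) = ‖c‖ ^ 4 * ssq (‖x‖ ^ 2 - ‖y‖ ^ 2) := by
    intro x y
    have : ‖c * x‖ ^ 2 - ‖c * y‖ ^ 2 = ‖c‖ ^ 2 * (‖x‖ ^ 2 - ‖y‖ ^ 2) := by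
      rw [norm_mul, norm_mul]; ring
    rw [this, ssq_mul (by positivity)]; ring
  have key2 : (c * w 0 * (c * w 5)) * conj (c * w 2 * (c * w 3)) =
      ((‖c‖ ^ 4 : ℝ) : ℂ) * ((w 0 * w 5) * conj (w 2 * w 3)) := by
    have : c * conj c = ((‖c‖ ^ 2 : ℝ) : ℂ) := by rw [mul_conj, normSq_eq_norm_sq]
    simp only [map_mul]
    push_cast at this ⊢
    linear_combination (c * conj c + (‖c‖:ℂ)^2) * (w 0 * w 5 * (conj (w 2) * conj (w 3))) * this
  unfold F
  ext i
  fin_cases i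
  · simpa using key _ _
  · simpa using key _ _
  · simpa using key _ _
  · have := congrArg Complex.re key2
    rw [re_ofReal_mul] at this
    simpa using this
  · have := congrArg Complex.im key2
    rw [im_ofReal_mul] at this
    simpa using this
  · simp; ring

lemma torus_norm {t : Fin 4 → ℂ} (ht : ∀ i, ‖t i‖ = 1) (k : Fin 6) : ‖torusCoef t k‖ = 1 := by
  fin_cases k <;> simp [torusCoef, ht]

lemma F_torus {t : Fin 4 → ℂ} (ht : ∀ i, ‖t i‖ = 1) (w w' : Fin 6 → ℂ)
    (h : ∀ k, w' k = torusCoef t k * w k) : F w' = F w := by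
  have hn : ∀ k, ‖w' k‖ = ‖w k‖ := fun k => by rw [h, norm_mul, torus_norm ht, one_mul]
  rw [F_eq_iff]
  simp only [norm_mul, hn, true_and, and_true]
  have hc : ∀ i, t i * conj (t i) = 1 := fun i => by
    rw [mul_conj, normSq_eq_norm_sq, ht]; simp
  have e1 : w' 0 * w' 5 = (t 0 * t 1 * t 2 * t 3) * (w 0 * w 5) := by
    rw [h, h]; simp [torusCoef]; ring
  have e2 : w' 2 * w' 3 = (t 0 * t 1 * t 2 * t 3) * (w 2 * w 3) := by
    rw [h, h]; simp [torusCoef]; ring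
  rw [e1, e2]
  generalize w 0 * w 5 = a
  generalize w 2 * w 3 = b
  simp only [map_mul]
  calc _ = (t 0 * conj (t 0)) * (t 1 * conj (t 1)) * (t 2 * conj (t 2)) * (t 3 * conj (t 3))
        * (a * conj b) := by ring
    _ = _ := by simp only [hc]; ring

lemma F_inj {w w' : Fin 6 → ℂ} (hw : w 0 * w 5 + w 2 * w 3 = w 1 * w 4)
    (hw' : w' 0 * w' 5 + w' 2 * w' 3 = w' 1 * w' 4) (h : F w' = F w) :
    ∃ t : Fin 4 → ℂ, (∀ i, ‖t i‖ = 1) ∧ ∀ k, w' k = torusCoef t k * w k := by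
  obtain ⟨h0, h1, h2, h3, h4⟩ := (F_eq_iff _ _).1 h
  obtain ⟨p, p', hp, hp', hpp, ha, hb⟩ := pair_inj (p := 1)
    (z := w 0 * w 5) (w := conj (w 2 * w 3)) (z' := w' 0 * w' 5) (w' := conj (w' 2 * w' 3))
    (by simp) (by rw [one_mul, h3])
    (by rw [norm_conj, norm_conj]; exact h4)
  have hp0 : p ≠ 0 := by rintro rfl; simp at hp
  have hpc : p * conj p = 1 := by rw [mul_conj, normSq_eq_norm_sq, hp]; simp
  have hb' : w' 2 * w' 3 = p * (w 2 * w 3) := by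
    have e : p' = conj p := mul_left_cancel₀ hp0 (hpp.trans hpc.symm)
    have := congrArg conj hb
    rwa [e, map_mul conj (conj p), conj_conj, conj_conj, conj_conj] at this
  have hc : w' 1 * w' 4 = p * (w 1 * w 4) := by
    rw [← hw', ← hw, ha, hb']; ring
  obtain ⟨s0, s5, n0, n5, m0, q0, q5⟩ := pair_inj hp ha h0
  obtain ⟨s1, s4, n1, n4, m1, q1, q4⟩ := pair_inj hp hc h1
  obtain ⟨s2, s3, n2, n3, m2, q2, q3⟩ := pair_inj hp hb' h2
  obtain ⟨r, hr⟩ := IsAlgClosed.exists_pow_nat_eq (s0 * s1 * s2 / p) (n := 2) two_pos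
  have hrn : ‖r‖ = 1 := by
    have := congrArg norm hr
    simp only [norm_pow, norm_div, norm_mul, n0, n1, n2, hp] at this
    exact (pow_eq_one_iff_of_nonneg (norm_nonneg r) two_ne_zero).1 (by simpa using this)
  have hr0 : r ≠ 0 := by rintro rfl; simp at hrn
  have ne : ∀ {z : ℂ}, ‖z‖ = 1 → z ≠ 0 := by rintro z hz rfl; simp at hz
  have k0 := ne n0
  have k1 := ne n1
  have k2 := ne n2
  have hr' : r ^ 2 * p = s0 * s1 * s2 := by rw [hr]; field_simp
  have f3 : s0 / r * (s1 / r) = s3 := by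
    field_simp
    apply mul_right_cancel₀ k2
    linear_combination -hr' - r ^ 2 * m2
  have f4 : s0 / r * (s2 / r) = s4 := by
    field_simp
    apply mul_right_cancel₀ k1
    linear_combination -hr' - r ^ 2 * m1
  have f5 : s1 / r * (s2 / r) = s5 := by
    field_simp
    apply mul_right_cancel₀ k0
    linear_combination -hr' - r ^ 2 * m0
  refine ⟨![r, s0 / r, s1 / r, s2 / r], ?_, ?_⟩
  · intro i
    fin_cases i <;> simp [hrn, n0, n1, n2]
  · intro k
    fin_cases k
    · simpa [torusCoef, mul_div_cancel₀, hr0] using q0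
    · simpa [torusCoef, mul_div_cancel₀, hr0] using q1
    · simpa [torusCoef, mul_div_cancel₀, hr0] using q2
    · simpa [torusCoef, f3] using q3
    · simpa [torusCoef, f4] using q4
    · simpa [torusCoef, f5] using q5

lemma F_surj (v : EuclideanSpace ℝ (Fin 6)) :
    ∃ w : Fin 6 → ℂ, w 0 * w 5 + w 2 * w 3 = w 1 * w 4 ∧ F w = v := by
  obtain ⟨a, b', hab, hn⟩ := pair_surj (v 5) ⟨v 3, v 4⟩
  obtain ⟨u0, hu0⟩ := ssq_surj (v 0)
  obtain ⟨u1, hu1⟩ := ssq_surj (v 1)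
  obtain ⟨u2, hu2⟩ := ssq_surj (v 2)
  obtain ⟨w0, w5, e0, d0⟩ := pair_surj u0 a
  obtain ⟨w2, w3, e2, d2⟩ := pair_surj u2 (conj b')
  obtain ⟨w1, w4, e1, d1⟩ := pair_surj u1 (a + conj b')
  refine ⟨![w0, w1, w2, w3, w4, w5], ?_, ?_⟩
  · change w0 * w5 + w2 * w3 = w1 * w4
    rw [e0, e1, e2]
  · ext i
    fin_cases i
    · change ssq (‖w0‖ ^ 2 - ‖w5‖ ^ 2) = v 0
      rw [d0, hu0]
    · change ssq (‖w1‖ ^ 2 - ‖w4‖ ^ 2) = v 1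
      rw [d1, hu1]
    · change ssq (‖w2‖ ^ 2 - ‖w3‖ ^ 2) = v 2
      rw [d2, hu2]
    · change ((w0 * w5) * conj (w2 * w3)).re = v 3
      rw [e0, e2, conj_conj, hab]
    · change ((w0 * w5) * conj (w2 * w3)).im = v 4
      rw [e0, e2, conj_conj, hab]
    · change ‖w0 * w5‖ ^ 2 - ‖w2 * w3‖ ^ 2 = v 5
      rw [e0, e2, norm_conj, hn]

lemma F_zero : F 0 = 0 := by
  have := F_smul 0 0
  simp only [zero_mul, norm_zero] at this
  rw [zero_pow (by norm_num), zero_smul] at this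
  exact this

lemma F_ne_zero {w : Fin 6 → ℂ} (h0 : w ≠ 0)
    (hw : w 0 * w 5 + w 2 * w 3 = w 1 * w 4) : F w ≠ 0 := by
  intro h
  obtain ⟨t, -, ht⟩ := F_inj (w := 0) (w' := w) (by simp) hw (h.trans F_zero.symm)
  exact h0 (funext fun k => by simp [ht k])

abbrev V := {w : Fin 6 → ℂ // w ≠ 0}

lemma projRel_equiv : Equivalence projRel where
  refl x := ⟨1, one_ne_zero, by simp⟩
  symm := by
    rintro x y ⟨c, hc, h⟩
    refine ⟨c⁻¹, inv_ne_zero hc, ?_⟩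
    rw [← h]
    funext k
    field_simp
  trans := by
    rintro x y z ⟨c, hc, h⟩ ⟨d, hd, h'⟩
    refine ⟨d * c, mul_ne_zero hd hc, ?_⟩
    rw [← h', ← h]
    funext k
    ring

lemma mk_eq {x y : V} (h : Quot.mk projRel x = Quot.mk projRel y) : projRel x y :=
  (projRel_equiv.quot_mk_eq_iff x y).1 h

lemma mem_iff (w : V) : Quot.mk projRel w ∈ pluckerQuadric ↔
    w.1 0 * w.1 5 + w.1 2 * w.1 3 = w.1 1 * w.1 4 := by
  constructor
  · rintro ⟨x, hx, h⟩
    obtain ⟨c, -, hc⟩ := mk_eq hx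
    rw [← hc]
    linear_combination c ^ 2 * h
  · exact fun h => ⟨w, rfl, h⟩

/-- Degree zero version of `F` on `ℂP⁵`. -/
noncomputable def G : CP5 → EuclideanSpace ℝ (Fin 6) :=
  Quot.lift (fun w => (‖w.1‖ ^ 4)⁻¹ • F w.1) (by
    rintro x y ⟨c, hc, h⟩
    have hn : ‖y.1‖ = ‖c‖ * ‖x.1‖ := by
      rw [← h, ← norm_smul]; rfl
    have hc' : ‖c‖ ≠ 0 := norm_ne_zero_iff.2 hc
    have hx : ‖x.1‖ ≠ 0 := norm_ne_zero_iff.2 x.2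
    change (‖x.1‖ ^ 4)⁻¹ • F x.1 = (‖y.1‖ ^ 4)⁻¹ • F y.1
    rw [hn, ← h, F_smul, smul_smul]
    congr 1
    field_simp)

lemma G_cont : Continuous G := by
  refine continuous_quot_lift _ ?_
  have h1 : Continuous fun w : V => ‖w.1‖ ^ 4 := by fun_prop
  exact Continuous.smul (h1.inv₀ fun w => pow_ne_zero _ (norm_ne_zero_iff.2 w.2))
    (F_cont.comp continuous_subtype_val)

lemma G_mk (w : V) : G (Quot.mk _ w) = (‖w.1‖ ^ 4)⁻¹ • F w.1 := rfl

lemma G_ne_zero (p : pluckerQuadric) : G p.1 ≠ 0 := by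
  obtain ⟨_, w, rfl, h⟩ := p
  rw [G_mk]
  exact smul_ne_zero (inv_ne_zero (pow_ne_zero _ (norm_ne_zero_iff.2 w.2))) (F_ne_zero w.2 h)

noncomputable def H (p : pluckerQuadric) : Metric.sphere (0 : EuclideanSpace ℝ (Fin 6)) 1 :=
  ⟨‖G p.1‖⁻¹ • G p.1, by
    rw [mem_sphere_zero_iff_norm, norm_smul, norm_inv, norm_norm,
      inv_mul_cancel₀ (norm_ne_zero_iff.2 (G_ne_zero p))]⟩

lemma H_cont : Continuous H := by
  have h : Continuous fun p : pluckerQuadric => G p.1 := G_cont.comp continuous_subtype_val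
  exact Continuous.subtype_mk
    ((h.norm.inv₀ fun p => norm_ne_zero_iff.2 (G_ne_zero p)).smul h) _

lemma H_val (w : V) (hw : Quot.mk projRel w ∈ pluckerQuadric) :
    (H ⟨_, hw⟩).1 = ‖F w.1‖⁻¹ • F w.1 := by
  have hx : ‖w.1‖ ≠ 0 := norm_ne_zero_iff.2 w.2
  change ‖G (Quot.mk _ w)‖⁻¹ • G (Quot.mk _ w) = _
  rw [G_mk, norm_smul, smul_smul, norm_inv, norm_pow, norm_norm]
  congr 1
  field_simp

lemma H_orbit (p q : pluckerQuadric) (h : orbitRel p q) : H p = H q := by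
  obtain ⟨p, hp⟩ := p
  obtain ⟨q, hq⟩ := q
  obtain ⟨t, ht, w, w', rfl, rfl, hk⟩ := h
  apply Subtype.ext
  rw [H_val, H_val, F_torus ht w.1 w'.1 hk]

lemma H_inj (p q : pluckerQuadric) (h : H p = H q) : orbitRel p q := by
  obtain ⟨_, w, rfl, hw⟩ := p
  obtain ⟨_, w', rfl, hw'⟩ := q
  have h1 := congrArg Subtype.val h
  rw [H_val w ((mem_iff w).2 hw), H_val w' ((mem_iff w').2 hw')] at h1
  have n1 : 0 < ‖F w.1‖ := norm_pos_iff.2 (F_ne_zero w.2 hw)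
  have n2 : 0 < ‖F w'.1‖ := norm_pos_iff.2 (F_ne_zero w'.2 hw')
  have h2 : F w'.1 = (‖F w'.1‖ / ‖F w.1‖) • F w.1 := by
    rw [div_eq_mul_inv, ← smul_smul, h1, smul_smul, mul_inv_cancel₀ n2.ne', one_smul]
  have hr : 0 < ‖F w'.1‖ / ‖F w.1‖ := div_pos n2 n1
  obtain ⟨c, hc, hc4⟩ : ∃ c : ℝ, 0 < c ∧ c ^ 4 = ‖F w'.1‖ / ‖F w.1‖ := by
    refine ⟨Real.sqrt (Real.sqrt (‖F w'.1‖ / ‖F w.1‖)), by positivity, ?_⟩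
    rw [show (4 : ℕ) = 2 * 2 from rfl, pow_mul, Real.sq_sqrt (by positivity),
      Real.sq_sqrt hr.le]
  have hc0 : (c : ℂ) ≠ 0 := by exact_mod_cast hc.ne'
  have hF : F w'.1 = F (fun k => (c : ℂ) * w.1 k) := by
    rw [F_smul, norm_real, Real.norm_of_nonneg hc.le, hc4, ← h2]
  obtain ⟨t, ht, hk⟩ := F_inj (w := fun k => (c : ℂ) * w.1 k)
    (by linear_combination (c : ℂ) ^ 2 * hw) hw' hF
  have hne : (fun k => (c : ℂ) * w.1 k) ≠ 0 := by
    intro h0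
    apply w.2
    funext k
    have := congrFun h0 k
    simpa [hc0] using this
  refine ⟨t, ht, ⟨_, hne⟩, w', ?_, rfl, hk⟩
  exact (Quot.sound ⟨(c : ℂ), hc0, rfl⟩).symm

lemma H_surj : Function.Surjective H := by
  rintro ⟨v, hv⟩
  rw [mem_sphere_zero_iff_norm] at hv
  obtain ⟨w, hw, hF⟩ := F_surj v
  have hne : w ≠ 0 := by
    rintro rfl
    rw [F_zero] at hF
    rw [← hF] at hv
    simp at hv
  refine ⟨⟨Quot.mk projRel ⟨w, hne⟩, (mem_iff _).2 hw⟩, ?_⟩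
  apply Subtype.ext
  rw [H_val]
  simp [hF, hv]

/-- The unit vectors satisfying the Plücker relation. -/
def K : Set (Fin 6 → ℂ) :=
  Metric.sphere 0 1 ∩ {w | w 0 * w 5 + w 2 * w 3 = w 1 * w 4}

lemma K_compact : IsCompact K :=
  (isCompact_sphere _ _).inter_right (isClosed_eq (by fun_prop) (by fun_prop))

lemma K_ne {w : Fin 6 → ℂ} (h : w ∈ K) : w ≠ 0 := by
  rintro rfl
  have := h.1
  simp at this

def toX (w : K) : pluckerQuadric := ⟨Quot.mk projRel ⟨w.1, K_ne w.2⟩, (mem_iff _).2 w.2.2⟩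

lemma toX_cont : Continuous toX := by
  refine Continuous.subtype_mk (continuous_quot_mk.comp ?_) _
  exact Continuous.subtype_mk continuous_subtype_val _

lemma toX_surj : Function.Surjective toX := by
  rintro ⟨_, w, rfl, h⟩
  have hn : ‖w.1‖ ≠ 0 := norm_ne_zero_iff.2 w.2
  have hc : ((‖w.1‖ : ℂ))⁻¹ ≠ 0 := inv_ne_zero (by exact_mod_cast hn)
  refine ⟨⟨fun k => ((‖w.1‖ : ℂ))⁻¹ * w.1 k, ?_, ?_⟩, ?_⟩
  · rw [mem_sphere_zero_iff_norm]
    change ‖((‖w.1‖ : ℂ))⁻¹ • w.1‖ = 1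
    rw [norm_smul, norm_inv, norm_real, norm_norm, inv_mul_cancel₀ hn]
  · change _ = _
    linear_combination ((‖w.1‖ : ℂ))⁻¹ ^ 2 * h
  · apply Subtype.ext
    exact (Quot.sound ⟨_, hc, rfl⟩).symm

lemma X_compact : CompactSpace pluckerQuadric := by
  have : CompactSpace K := isCompact_iff_compactSpace.1 K_compact
  exact toX_surj.compactSpace toX_cont

end OrbitSphere

/-- the orbit space `G₄,₂/T⁴` is homeomorphic to the sphere `S⁵`,
the unit sphere of `ℝ⁶`. -/
theorem orbitSpace_homeomorph_sphere :
    Nonempty (Quot orbitRel ≃ₜ Metric.sphere (0 : EuclideanSpace ℝ (Fin 6)) 1) := by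
  have := OrbitSphere.X_compact
  let f : Quot orbitRel → Metric.sphere (0 : EuclideanSpace ℝ (Fin 6)) 1 :=
    Quot.lift OrbitSphere.H OrbitSphere.H_orbit
  have hf : Continuous f := continuous_quot_lift _ OrbitSphere.H_cont
  have hbij : Function.Bijective f := by
    constructor
    · rintro ⟨p⟩ ⟨q⟩ h
      exact Quot.sound (OrbitSphere.H_inj p q h)
    · intro v
      obtain ⟨p, hp⟩ := OrbitSphere.H_surj v
      exact ⟨Quot.mk _ p, hp⟩
  exact ⟨Continuous.homeoOfEquivCompactToT2 (f := Equiv.ofBijective f hbij) hf⟩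
end

section
/- The orbit space X/T⁴ of the canonical T⁴-action on the Grassmannian G₄,₂ (realized as the Plücker quadric X) is simply connected (in particular path-connected with trivial fundamental group). -/
theorem vk_simplyConnected {Y ι : Type*} [TopologicalSpace Y] (U : ι → Set Y) (x₀ : Y)
    (hU : ∀ i, IsOpen (U i)) (hcov : ∀ y, ∃ i, y ∈ U i)
    (hsc : ∀ i, IsSimplyConnected (U i))
    (hj : ∀ i j y, y ∈ U i → y ∈ U j → JoinedIn (U i ∩ U j) x₀ y) :
    SimplyConnectedSpace Y := by
  -- two paths within `U i` are homotopic
  have hom : ∀ i (x y : Y) (p q : Path x y), (∀ t, p t ∈ U i) → (∀ t, q t ∈ U i) →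
      p.Homotopic q := by
    intro i x y p q hp hq
    have := (hsc i).simplyConnectedSpace
    have hx : x ∈ U i := by simpa using hp 0
    have hy : y ∈ U i := by simpa using hp 1
    let p' : Path (⟨x, hx⟩ : U i) ⟨y, hy⟩ :=
      { toFun := fun t => ⟨p t, hp t⟩, source' := by simp, target' := by simp }
    let q' : Path (⟨x, hx⟩ : U i) ⟨y, hy⟩ :=
      { toFun := fun t => ⟨q t, hq t⟩, source' := by simp, target' := by simp }
    exact (SimplyConnectedSpace.paths_homotopic p' q').map ⟨Subtype.val, continuous_subtype_val⟩
  choose s hs using hcov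
  let c : ∀ y, Path x₀ y := fun y => (hj (s y) (s y) y (hs y) (hs y)).somePath
  have hc : ∀ i y (p : Path x₀ y), (∀ t, p t ∈ U i) → p.Homotopic (c y) := by
    intro i y p hp
    have hy : y ∈ U i := by simpa using hp 1
    have h := hj i (s y) y hy (hs y)
    refine (hom i _ _ p h.somePath hp fun t => (h.somePath_mem t).1).trans ?_
    exact hom (s y) _ _ _ _ (fun t => (h.somePath_mem t).2)
      fun t => ((hj (s y) (s y) y (hs y) (hs y)).somePath_mem t).1
  -- small paths
  have small : ∀ i (x y : Y) (p : Path x y), (∀ t, p t ∈ U i) →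
      ((c x).trans p).Homotopic (c y) := by
    intro i x y p hp
    have hx : x ∈ U i := by simpa using hp 0
    have h := hj i i x hx hx
    refine ((hc i x h.somePath fun t => (h.somePath_mem t).1).symm.hcomp
      (Path.Homotopic.refl p)).trans (hc i y _ ?_)
    intro t
    have : (h.somePath.trans p) t ∈ Set.range (h.somePath.trans p) := ⟨t, rfl⟩
    rw [Path.trans_range] at this
    rcases this with ⟨u, hu⟩ | ⟨u, hu⟩
    · rw [← hu]; exact (h.somePath_mem u).1
    · rw [← hu]; exact hp u
  have big : ∀ (x y : Y) (p : Path x y), ((c x).trans p).Homotopic (c y) := by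
    intro x y p
    obtain ⟨t, ht0, htm, ⟨n, hn⟩, ht⟩ :=
      exists_monotone_Icc_subset_open_cover_unitInterval (c := fun i => p ⁻¹' U i)
        (fun i => (hU i).preimage p.continuous)
        (fun a _ => Set.mem_iUnion.2 ⟨s (p a), hs _⟩)
    have key : ∀ m, ((c (p 0)).trans (p.subpath 0 (t m))).Homotopic (c (p (t m))) := by
      intro m
      induction m with
      | zero =>
        rw [ht0]
        refine small (s (p 0)) _ _ _ ?_
        intro u
        simpa using hs (p 0)
      | succ m ih =>
        obtain ⟨i, hi⟩ := ht m
        have h1 : ((c (p (t m))).trans (p.subpath (t m) (t (m+1)))).Homotopic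
            (c (p (t (m+1)))) := by
          refine small i _ _ _ ?_
          intro u
          have : (p.subpath (t m) (t (m+1))) u ∈ Set.range (p.subpath (t m) (t (m+1))) := ⟨u, rfl⟩
          rw [Path.range_subpath_of_le _ _ _ (htm (Nat.le_succ m))] at this
          obtain ⟨v, hv, hv'⟩ := this
          rw [← hv']; exact hi hv
        have h2 : ((p.subpath 0 (t m)).trans (p.subpath (t m) (t (m+1)))).Homotopic
            (p.subpath 0 (t (m+1))) := ⟨Path.Homotopy.subpathTransSubpath p _ _ _⟩
        refine ((Path.Homotopic.refl _).hcomp h2.symm).trans ?_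
        refine Path.Homotopic.trans ⟨(Path.Homotopy.transAssoc _ _ _).symm⟩ ?_
        exact (ih.hcomp (Path.Homotopic.refl _)).trans h1
    have := key n
    rw [hn n le_rfl] at this
    have aux : ∀ a b (ha : a = x) (hb : b = y),
        ((c a).trans (p.cast ha hb)).Homotopic (c b) → ((c x).trans p).Homotopic (c y) := by
      rintro _ _ rfl rfl h
      exact h
    rw [Path.subpath_zero_one] at this
    exact aux _ _ _ _ this
  rw [simply_connected_iff_paths_homotopic']
  refine ⟨⟨⟨x₀⟩, fun x y => ⟨(c x).symm.trans (c y)⟩⟩, ?_⟩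
  intro x y p q
  have h := (big x y p).trans (big x y q).symm
  rw [← Path.Homotopic.Quotient.eq] at h ⊢
  simp only [Path.Homotopic.Quotient.mk_trans] at h
  have hcancel := congrArg (fun z => Path.Homotopic.Quotient.trans
    (Path.Homotopic.Quotient.symm (Path.Homotopic.Quotient.mk (c x))) z) h
  simpa [← Path.Homotopic.Quotient.trans_assoc] using hcancel

/-- The affine cone over the quadric, minus the origin. -/
abbrev qCone := {w : Fin 6 → ℂ // w ≠ 0 ∧ w 0 * w 5 + w 2 * w 3 = w 1 * w 4}

theorem quadric_iff (w : {w : Fin 6 → ℂ // w ≠ 0}) :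
    Quot.mk projRel w ∈ pluckerQuadric ↔ w.1 0 * w.1 5 + w.1 2 * w.1 3 = w.1 1 * w.1 4 := by
  constructor
  · rintro ⟨v, hv, hq⟩
    have hinv : ∀ x y, projRel x y →
        ((x.1 0 * x.1 5 + x.1 2 * x.1 3 = x.1 1 * x.1 4) =
          (y.1 0 * y.1 5 + y.1 2 * y.1 3 = y.1 1 * y.1 4)) := by
      rintro x y ⟨c, hc, h⟩
      rw [← h]
      simp only [eq_iff_iff]
      constructor
      · intro h; linear_combination c ^ 2 * h
      · intro h
        have : c ^ 2 ≠ 0 := pow_ne_zero 2 hc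
        apply mul_left_cancel₀ this
        linear_combination h
    have := congrArg (Quot.lift (fun x : {w : Fin 6 → ℂ // w ≠ 0} =>
      (x.1 0 * x.1 5 + x.1 2 * x.1 3 = x.1 1 * x.1 4)) hinv) hv
    simp only at this
    rw [← this]; exact hq
  · intro h
    exact ⟨w, rfl, h⟩

theorem quadric_closed : IsClosed pluckerQuadric := by
  have hq : Topology.IsQuotientMap (Quot.mk projRel) := isQuotientMap_quot_mk
  rw [← hq.isClosed_preimage]
  have : Quot.mk projRel ⁻¹' pluckerQuadric =
      {w | w.1 0 * w.1 5 + w.1 2 * w.1 3 = w.1 1 * w.1 4} := by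
    ext w; exact quadric_iff w
  rw [this]
  have hc : ∀ k, Continuous fun w : {w : Fin 6 → ℂ // w ≠ 0} => w.1 k := fun k =>
    (continuous_apply k).comp continuous_subtype_val
  exact isClosed_eq (((hc 0).mul (hc 5)).add ((hc 2).mul (hc 3))) ((hc 1).mul (hc 4))

/-- The projection of the cone to the quadric. -/
def coneToX (w : qCone) : ↥pluckerQuadric :=
  ⟨Quot.mk projRel ⟨w.1, w.2.1⟩, (quadric_iff _).2 w.2.2⟩

theorem coneToX_quotient : Topology.IsQuotientMap coneToX := by
  have hq : Topology.IsQuotientMap (Quot.mk projRel) := isQuotientMap_quot_mk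
  have h1 : Topology.IsQuotientMap (pluckerQuadric.restrictPreimage (Quot.mk projRel)) :=
by
    refine Topology.isQuotientMap_iff_isClosed.2 ⟨hq.surjective.restrictPreimage _, fun s => ?_⟩
    rw [quadric_closed.isClosedEmbedding_subtypeVal.isClosed_iff_image_isClosed,
      ← hq.isClosed_preimage, (quadric_closed.preimage
        hq.continuous).isClosedEmbedding_subtypeVal.isClosed_iff_image_isClosed,
      Set.image_val_preimage_restrictPreimage]
  let e : qCone ≃ₜ (Quot.mk projRel ⁻¹' pluckerQuadric) :=
    { toFun := fun w => ⟨⟨w.1, w.2.1⟩, (quadric_iff _).2 w.2.2⟩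
      invFun := fun w => ⟨w.1.1, w.1.2, (quadric_iff _).1 w.2⟩
      left_inv := fun _ => rfl
      right_inv := fun _ => rfl
      continuous_toFun := by fun_prop
      continuous_invFun := by fun_prop }
  exact h1.comp e.isQuotientMap

/-- The projection of the cone to the orbit space. -/
def coneToY (w : qCone) : Quot orbitRel := Quot.mk orbitRel (coneToX w)

theorem coneToY_quotient : Topology.IsQuotientMap coneToY :=
  Topology.IsQuotientMap.comp (isQuotientMap_quot_mk (r := orbitRel)) coneToX_quotient

theorem torusCoef_ne (t : Fin 4 → ℂ) (ht : ∀ i, ‖t i‖ = 1) (k : Fin 6) : torusCoef t k ≠ 0 := by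
  have h : ∀ i, t i ≠ 0 := fun i h => by have := ht i; simp [h] at this
  fin_cases k <;> simp [torusCoef, h]

/-- Any function on the cone invariant under scalars and the torus descends. -/
theorem descends {Z : Type*} (f : qCone → Z)
    (h1 : ∀ (w w' : qCone) (c : ℂ), c ≠ 0 → (∀ k, w'.1 k = c * w.1 k) → f w = f w')
    (h2 : ∀ (w w' : qCone) (t : Fin 4 → ℂ), (∀ i, ‖t i‖ = 1) →
      (∀ k, w'.1 k = torusCoef t k * w.1 k) → f w = f w') :
    ∃ g : Quot orbitRel → Z, ∀ w, g (coneToY w) = f w := by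
  have key : ∀ (v w : {w : Fin 6 → ℂ // w ≠ 0}), Quot.mk projRel v = Quot.mk projRel w →
      ∃ c : ℂ, c ≠ 0 ∧ ∀ k, w.1 k = c * v.1 k := by
    intro v w h
    have := Quot.eqvGen_exact h
    clear h
    induction this with
    | rel x y h =>
      obtain ⟨c, hc, h⟩ := h
      exact ⟨c, hc, fun k => by rw [← h]⟩
    | refl x => exact ⟨1, one_ne_zero, fun k => by simp⟩
    | symm x y _ ih =>
      obtain ⟨c, hc, h⟩ := ih
      exact ⟨c⁻¹, inv_ne_zero hc, fun k => by rw [h k]; field_simp⟩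
    | trans x y z _ _ ih1 ih2 =>
      obtain ⟨c, hc, h⟩ := ih1
      obtain ⟨d, hd, h'⟩ := ih2
      exact ⟨d * c, mul_ne_zero hd hc, fun k => by rw [h' k, h k]; ring⟩
  have hX : ∀ w w' : qCone, coneToX w = coneToX w' → f w = f w' := by
    intro w w' h
    obtain ⟨c, hc, h⟩ := key _ _ (congrArg Subtype.val h)
    exact h1 w w' c hc h
  choose s hs using coneToX_quotient.surjective
  refine ⟨Quot.lift (fun p => f (s p)) ?_, fun w => hX _ _ (hs _)⟩
  rintro p q ⟨t, ht, v, v', hv, hv', h⟩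
  have hvq := (quadric_iff v).1 (hv ▸ p.2)
  have hvq' := (quadric_iff v').1 (hv' ▸ q.2)
  have e1 : f (s p) = f ⟨v.1, v.2, hvq⟩ := hX _ _ ((hs p).trans (Subtype.ext hv.symm))
  have e2 : f (s q) = f ⟨v'.1, v'.2, hvq'⟩ := hX _ _ ((hs q).trans (Subtype.ext hv'.symm))
  change f (s p) = f (s q)
  rw [e1, e2]
  exact h2 _ _ t ht h

theorem coneToY_scal (w w' : qCone) (c : ℂ) (hc : c ≠ 0) (h : ∀ k, w'.1 k = c * w.1 k) :
    coneToY w = coneToY w' := by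
  refine congrArg (Quot.mk orbitRel) (Subtype.ext (Quot.sound ⟨c, hc, ?_⟩))
  funext k; exact (h k).symm

theorem coneToY_torus (w w' : qCone) (t : Fin 4 → ℂ) (ht : ∀ i, ‖t i‖ = 1)
    (h : ∀ k, w'.1 k = torusCoef t k * w.1 k) : coneToY w = coneToY w' :=
  Quot.sound ⟨t, ht, ⟨w.1, w.2.1⟩, ⟨w'.1, w'.2.1⟩, rfl, rfl, h⟩

/-- The chart where the `k`-th coordinate is nonzero. -/
def chart (k : Fin 6) : Set (Quot orbitRel) := {y | ∃ w : qCone, coneToY w = y ∧ w.1 k ≠ 0}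

theorem mem_chart (k : Fin 6) (w : qCone) : coneToY w ∈ chart k ↔ w.1 k ≠ 0 := by
  obtain ⟨g, hg⟩ := descends (fun w : qCone => w.1 k ≠ 0)
    (fun w w' c hc h => by simp [h k, hc])
    (fun w w' t ht h => by simp [h k, torusCoef_ne t ht k])
  constructor
  · rintro ⟨v, hv, h⟩
    have := hg v
    rw [hv, hg w] at this
    rw [this]; exact h
  · exact fun h => ⟨w, rfl, h⟩

theorem chart_open (k : Fin 6) : IsOpen (chart k) := by
  rw [← coneToY_quotient.isOpen_preimage]
  have : coneToY ⁻¹' chart k = {w | w.1 k ≠ 0} := by ext w; exact mem_chart k w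
  rw [this]
  exact isOpen_ne_fun ((continuous_apply k).comp continuous_subtype_val) continuous_const

theorem chart_cover (y : Quot orbitRel) : ∃ k, y ∈ chart k := by
  obtain ⟨w, rfl⟩ := coneToY_quotient.surjective y
  obtain ⟨k, hk⟩ := Function.ne_iff.1 w.2.1
  exact ⟨k, (mem_chart k w).2 hk⟩

/-- Weights of the contraction onto the `k`-th fixed point. -/
def wt (k j : Fin 6) : ℕ := if j = k then 0 else if j = Fin.rev k then 2 else 1

theorem wt_quadric (k : Fin 6) (s : ℂ) (w : Fin 6 → ℂ)
    (h : w 0 * w 5 + w 2 * w 3 = w 1 * w 4) :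
    (s ^ wt k 0 * w 0) * (s ^ wt k 5 * w 5) + (s ^ wt k 2 * w 2) * (s ^ wt k 3 * w 3)
      = (s ^ wt k 1 * w 1) * (s ^ wt k 4 * w 4) := by
  have h05 : wt k 0 + wt k 5 = 2 := by revert k; decide
  have h23 : wt k 2 + wt k 3 = 2 := by revert k; decide
  have h14 : wt k 1 + wt k 4 = 2 := by revert k; decide
  have e05 : s ^ wt k 0 * s ^ wt k 5 = s ^ 2 := by rw [← pow_add, h05]
  have e23 : s ^ wt k 2 * s ^ wt k 3 = s ^ 2 := by rw [← pow_add, h23]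
  have e14 : s ^ wt k 1 * s ^ wt k 4 = s ^ 2 := by rw [← pow_add, h14]
  linear_combination w 0 * w 5 * e05 + w 2 * w 3 * e23 - w 1 * w 4 * e14 + s ^ 2 * h

/-- The contraction upstairs. -/
def contr (k : Fin 6) (w : coneToY ⁻¹' chart k) (s : unitInterval) : qCone :=
  ⟨fun j => ((s : ℝ) : ℂ) ^ wt k j * w.1.1 j, by
    have hw : w.1.1 k ≠ 0 := (mem_chart k w.1).1 w.2
    refine ⟨fun h => hw ?_, wt_quadric k _ _ w.1.2.2⟩
    simpa [wt] using congrFun h k⟩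

theorem contr_mem (k : Fin 6) (w : coneToY ⁻¹' chart k) (s : unitInterval) :
    coneToY (contr k w s) ∈ chart k := by
  have hw : w.1.1 k ≠ 0 := (mem_chart k w.1).1 w.2
  rw [mem_chart]
  simpa [contr, wt] using hw

theorem contr_cont (k : Fin 6) :
    Continuous (fun p : (coneToY ⁻¹' chart k) × unitInterval => contr k p.1 p.2) := by
  unfold contr
  refine Continuous.subtype_mk (continuous_pi fun j => ?_) _
  refine Continuous.mul ?_ ?_
  · fun_prop
  · exact (continuous_apply j).comp
      (continuous_subtype_val.comp (continuous_subtype_val.comp continuous_fst))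

/-- The contraction in the orbit space, as a map into the path space. -/
def contrMap (k : Fin 6) (w : coneToY ⁻¹' chart k) : C(unitInterval, chart k) where
  toFun s := ⟨coneToY (contr k w s), contr_mem k w s⟩
  continuous_toFun := by
    refine Continuous.subtype_mk (coneToY_quotient.continuous.comp ?_) _
    exact (contr_cont k).comp (Continuous.prodMk_right w)

theorem contrMap_cont (k : Fin 6) : Continuous (contrMap k) := by
  refine ContinuousMap.continuous_of_continuous_uncurry _ ?_
  refine Continuous.subtype_mk (coneToY_quotient.continuous.comp ?_) _
  exact contr_cont k

/-- The fixed point `e_k`. -/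
def fixPt (k : Fin 6) : qCone := ⟨Pi.single k 1, by simp, by fin_cases k <;> simp⟩

theorem contrMap_inv (k : Fin 6) (w w' : coneToY ⁻¹' chart k)
    (h : coneToY w.1 = coneToY w'.1) : contrMap k w = contrMap k w' := by
  classical
  let f : qCone → unitInterval → Quot orbitRel := fun w s =>
    if hw : coneToY w ∈ chart k then coneToY (contr k ⟨w, hw⟩ s) else coneToY w
  obtain ⟨g, hg⟩ := descends f (by
    intro w w' c hc h
    have e := coneToY_scal w w' c hc h
    funext s
    by_cases hw : coneToY w ∈ chart k
    · have hw' : coneToY w' ∈ chart k := e ▸ hw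
      simp only [f, hw, hw', dif_pos]
      refine coneToY_scal _ _ c hc fun j => ?_
      simp only [contr, h j]; ring
    · have hw' : coneToY w' ∉ chart k := e ▸ hw
      simp only [f, hw, hw', dif_neg, not_false_iff]
      exact e) (by
    intro w w' t ht h
    have e := coneToY_torus w w' t ht h
    funext s
    by_cases hw : coneToY w ∈ chart k
    · have hw' : coneToY w' ∈ chart k := e ▸ hw
      simp only [f, hw, hw', dif_pos]
      refine coneToY_torus _ _ t ht fun j => ?_
      simp only [contr, h j]; ring
    · have hw' : coneToY w' ∉ chart k := e ▸ hw
      simp only [f, hw, hw', dif_neg, not_false_iff]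
      exact e)
  have e : f w.1 = f w'.1 := by rw [← hg, ← hg, h]
  ext s
  have := congrFun e s
  have hw : coneToY w.1 ∈ chart k := w.2
  have hw' : coneToY w'.1 ∈ chart k := w'.2
  simp only [f, hw, hw', dif_pos] at this
  exact this

theorem chart_sc (k : Fin 6) : IsSimplyConnected (chart k) := by
  have hq := coneToY_quotient.restrictPreimage_isOpen (chart_open k)
  have hinv : ∀ a b, (chart k).restrictPreimage coneToY a = (chart k).restrictPreimage coneToY b →
      contrMap k a = contrMap k b := fun a b h => contrMap_inv k a b (congrArg Subtype.val h)
  let q' : C(coneToY ⁻¹' chart k, chart k) := ⟨_, hq.continuous⟩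
  have hq' : Topology.IsQuotientMap q' := hq
  let F : C(chart k, C(unitInterval, chart k)) :=
    hq'.lift ⟨contrMap k, contrMap_cont k⟩
      hinv
  have hF : ∀ w, F ((chart k).restrictPreimage coneToY w) = contrMap k w := fun w =>
    DFunLike.congr_fun (hq'.lift_comp ⟨contrMap k, contrMap_cont k⟩
      hinv) w
  have hk : coneToY (fixPt k) ∈ chart k := (mem_chart _ _).2 (by simp [fixPt])
  have : ContractibleSpace (chart k) := by
    rw [contractible_iff_id_nullhomotopic]
    refine ⟨⟨coneToY (fixPt k), hk⟩, ContinuousMap.Homotopic.symm ⟨?_⟩⟩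
    refine ⟨⟨fun p => F p.2 p.1, by fun_prop⟩, ?_, ?_⟩
    · intro y
      obtain ⟨w, rfl⟩ := hq.surjective y
      have hw : w.1.1 k ≠ 0 := (mem_chart k w.1).1 w.2
      change F _ 0 = _
      rw [hF]
      apply Subtype.ext
      refine (coneToY_scal _ _ (w.1.1 k) hw fun j => ?_).symm
      by_cases hj : j = k
      · subst hj; simp [contr, fixPt, wt]
      · have : wt k j ≠ 0 := by unfold wt; split_ifs <;> simp_all
        simp [contr, fixPt, hj, this]
    · intro y
      obtain ⟨w, rfl⟩ := hq.surjective y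
      change F _ 1 = _
      rw [hF]
      apply Subtype.ext
      change coneToY _ = coneToY _
      congr 1
      apply Subtype.ext
      funext j
      simp [contr]
  exact (inferInstance : SimplyConnectedSpace (chart k))

/-- A generic base point. -/
def basePt : qCone := ⟨![1, 2, 1, 1, 1, 1], fun h => by simpa using congrFun h 0, by
  simp; norm_num⟩

theorem basePt_ne (k : Fin 6) : basePt.1 k ≠ 0 := by
  fin_cases k <;> simp [basePt]

theorem exists_curve (k : Fin 6) (w v : Fin 6 → ℂ) (hwk : w k = 1) (hvk : v k = 1)
    (hw : w 0 * w 5 + w 2 * w 3 = w 1 * w 4) (hv : v 0 * v 5 + v 2 * v 3 = v 1 * v 4) :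
    ∃ d : Fin 6 → ℂ, d k = 0 ∧ ∀ z : ℂ, ∀ u : Fin 6 → ℂ,
      (∀ j, u j = (1 - z) * w j + z * v j + z * (1 - z) * d j) →
      u 0 * u 5 + u 2 * u 3 = u 1 * u 4 := by
  let b := w 0 * v 5 + w 5 * v 0 + w 2 * v 3 + w 3 * v 2 - w 1 * v 4 - w 4 * v 1
  let e : ℂ := if k = 1 ∨ k = 4 then 1 else -1
  refine ⟨Pi.single (Fin.rev k) (e * b), ?_, ?_⟩
  · fin_cases k <;> simp [Fin.rev]
  · intro z u hu
    simp only [hu]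
    fin_cases k <;> simp [Fin.rev, e, b] at hwk hvk ⊢ <;>
      rw [hwk] at hw ⊢ <;> rw [hvk] at hv ⊢ <;>
      linear_combination (1 - z) ^ 2 * hw + z ^ 2 * hv

theorem chart_joined (k l : Fin 6) (y : Quot orbitRel) (hk : y ∈ chart k) (hl : y ∈ chart l) :
    JoinedIn (chart k ∩ chart l) (coneToY basePt) y := by
  obtain ⟨w, rfl⟩ := coneToY_quotient.surjective y
  rw [mem_chart] at hk hl
  -- normalise the `k`-th coordinate
  have norm : ∀ w : qCone, w.1 k ≠ 0 → ∃ w' : qCone, coneToY w = coneToY w' ∧ w'.1 k = 1 ∧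
      ∀ j, w.1 j ≠ 0 → w'.1 j ≠ 0 := by
    intro w hk
    let w' : qCone := ⟨fun j => (w.1 k)⁻¹ * w.1 j,
      fun h => by simpa [hk] using congrFun h k,
      by linear_combination ((w.1 k)⁻¹) ^ 2 * w.2.2⟩
    refine ⟨w', coneToY_scal w w' _ (inv_ne_zero hk) fun j => rfl, ?_, ?_⟩
    · simp [w', hk]
    · intro j hj; simp [w', hk, hj]
  obtain ⟨v, hv, hvk, hvn⟩ := norm basePt (basePt_ne k)
  obtain ⟨x, hx, hxk, hxn⟩ := norm w hk
  rw [hv, hx]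
  have hvl := hvn l (basePt_ne l)
  have hxl := hxn l hl
  obtain ⟨d, hdk, hd⟩ := exists_curve k v.1 x.1 hvk hxk v.2.2 x.2.2
  let u : ℂ → qCone := fun z => ⟨fun j => (1 - z) * v.1 j + z * x.1 j + z * (1 - z) * d j,
    fun h => by
      have := congrFun h k
      simp [hvk, hxk, hdk] at this, hd z _ fun _ => rfl⟩
  have hu : Continuous u := by
    refine Continuous.subtype_mk ?_ _
    fun_prop
  have hu0 : u 0 = v := by apply Subtype.ext; funext j; simp [u]
  have hu1 : u 1 = x := by apply Subtype.ext; funext j; simp [u]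
  have huk : ∀ z, (u z).1 k = 1 := fun z => by simp [u, hvk, hxk, hdk]
  -- the bad set is finite
  let P : Polynomial ℂ := (1 - Polynomial.X) * Polynomial.C (v.1 l) +
    Polynomial.X * Polynomial.C (x.1 l) +
    Polynomial.X * (1 - Polynomial.X) * Polynomial.C (d l)
  have hP : ∀ z, P.eval z = (u z).1 l := fun z => by
    simp only [P, u, Polynomial.eval_add, Polynomial.eval_mul, Polynomial.eval_sub,
      Polynomial.eval_one, Polynomial.eval_X, Polynomial.eval_C]
  have hP0 : P ≠ 0 := by
    intro h
    have := hP 0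
    rw [hu0, h] at this
    exact hvl (by simpa using this.symm)
  have hfin : {z | (u z).1 l = 0}.Finite := by
    refine (P.roots.toFinset.finite_toSet).subset ?_
    intro z hz
    simp only [Finset.mem_coe, Multiset.mem_toFinset, Polynomial.mem_roots hP0, Polynomial.IsRoot]
    rw [hP]; exact hz
  have hpc := hfin.countable.isPathConnected_compl_of_one_lt_rank (by simp [Complex.rank_real_complex])
  have hj := hpc.joinedIn 0 (by simpa [hu0] using hvl) 1 (by simpa [hu1] using hxl)
  have := hj.map_continuousOn (f := coneToY ∘ u) (coneToY_quotient.continuous.comp hu).continuousOn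
  rw [Function.comp_apply, Function.comp_apply, hu0, hu1] at this
  refine this.mono ?_
  rintro _ ⟨z, hz, rfl⟩
  exact ⟨(mem_chart _ _).2 (by rw [huk]; exact one_ne_zero), (mem_chart _ _).2 hz⟩

/-- the orbit space `G₄,₂/T⁴` is simply connected
(in particular path-connected with trivial fundamental group). -/
theorem orbitSpace_simplyConnected : SimplyConnectedSpace (Quot orbitRel) := by
  exact vk_simplyConnected chart (coneToY basePt) chart_open chart_cover chart_sc chart_joined
end
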